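/- arXiv:1910.10533 — 4 statements merged into one kernel-verified Lean document; each statement's English description precedes it below -/
import Mathlib

section
/- Let G be a finite group and ρ : G → GL₃(ℂ) a group homomorphism whose induced action on the complex projective plane ℙ² has no fixed point. If v ∈ ℂ³ is nonzero and the orbit {[ρ(g)v] : g ∈ G} of the point [v] contains at least four distinct points of ℙ², then there exist g₁, g₂, g₃, g₄ ∈ G such that any three of the four vectors ρ(g₁)v, ρ(g₂)v, ρ(g₃)v, ρ(g₄)v are linearly independent over ℂ (i.e., the orbit contains four points no three of which are collinear). -/
open Matrix

/-- The determinant of the matrix with rows `p`, `q`, `r`, as a function of the rows. -/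
def rowDet (p q r : Fin 3 → ℂ) : ℂ := Matrix.det (of ![p, q, r])

lemma rowDet_eq (p q r : Fin 3 → ℂ) : rowDet p q r =
    p 0 * q 1 * r 2 - p 0 * q 2 * r 1 - p 1 * q 0 * r 2 + p 1 * q 2 * r 0 +
      p 2 * q 0 * r 1 - p 2 * q 1 * r 0 := by
  simp [rowDet, det_fin_three]

lemma rowDet_comb (p q r : Fin 3 → ℂ) (a₁ b₁ c₁ a₂ b₂ c₂ a₃ b₃ c₃ : ℂ) :
    rowDet (a₁ • p + b₁ • q + c₁ • r) (a₂ • p + b₂ • q + c₂ • r) (a₃ • p + b₃ • q + c₃ • r) =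
      (a₁ * (b₂ * c₃ - c₂ * b₃) - b₁ * (a₂ * c₃ - c₂ * a₃) + c₁ * (a₂ * b₃ - b₂ * a₃)) *
        rowDet p q r := by
  simp only [rowDet_eq, Pi.add_apply, Pi.smul_apply, smul_eq_mul]
  ring

lemma rowDet_mulVec (M : Matrix (Fin 3) (Fin 3) ℂ) (p q r : Fin 3 → ℂ) :
    rowDet (M *ᵥ p) (M *ᵥ q) (M *ᵥ r) = M.det * rowDet p q r := by
  simp only [rowDet_eq, det_fin_three, mulVec, dotProduct, Fin.sum_univ_three]
  ring

lemma exists_comb_of_rowDet_ne_zero {p q r : Fin 3 → ℂ} (h : rowDet p q r ≠ 0)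
    (y : Fin 3 → ℂ) : ∃ a b c : ℂ, y = a • p + b • q + c • r := by
  let P : Matrix (Fin 3) (Fin 3) ℂ := of ![p, q, r]
  have hP : IsUnit P.det := isUnit_iff_ne_zero.mpr h
  have hy : (y ᵥ* P⁻¹) ᵥ* P = y := by
    rw [vecMul_vecMul, nonsing_inv_mul _ hP, vecMul_one]
  refine ⟨(y ᵥ* P⁻¹) 0, (y ᵥ* P⁻¹) 1, (y ᵥ* P⁻¹) 2, ?_⟩
  nth_rewrite 1 [← hy]
  ext i
  simp [vecMul, dotProduct, Fin.sum_univ_three, P]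

/-- No four vectors of `S` represent points of the projective plane in general position. -/
def NoQuadrangle (S : Set (Fin 3 → ℂ)) : Prop :=
  ∀ u₁ ∈ S, ∀ u₂ ∈ S, ∀ u₃ ∈ S, ∀ u₄ ∈ S, rowDet u₁ u₂ u₃ ≠ 0 → rowDet u₁ u₂ u₄ ≠ 0 →
    rowDet u₁ u₃ u₄ ≠ 0 → rowDet u₂ u₃ u₄ = 0

namespace NoQuadrangle

variable {S : Set (Fin 3 → ℂ)} {p q r : Fin 3 → ℂ} {α β : ℂ}

lemma coord_eq_zero (hS : NoQuadrangle S) (hp : p ∈ S) (hq : q ∈ S) (hr : r ∈ S)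
    (h : rowDet p q r ≠ 0) {a b c : ℂ} (hy : a • p + b • q + c • r ∈ S) :
    a = 0 ∨ b = 0 ∨ c = 0 := by
  by_contra! hne
  obtain ⟨ha, hb, hc⟩ := hne
  have h₁ := rowDet_comb p q r 1 0 0 0 1 0 a b c
  have h₂ := rowDet_comb p q r 1 0 0 0 0 1 a b c
  have h₃ := rowDet_comb p q r 0 1 0 0 0 1 a b c
  simp only [one_smul, zero_smul, add_zero, zero_add] at h₁ h₂ h₃
  refine absurd (hS p hp q hq r hr _ hy h ?_ ?_) ?_
  · rw [h₁]; exact mul_ne_zero (by simpa using hc) h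
  · rw [h₂]; exact mul_ne_zero (by simpa using hb) h
  · rw [h₃]; exact mul_ne_zero (by simpa using ha) h

lemma coord_eq_zero_of_mem_line (hS : NoQuadrangle S) (hq : q ∈ S) (hr : r ∈ S)
    (h : rowDet p q r ≠ 0) (hα : α ≠ 0) (hβ : β ≠ 0) (hx : α • p + β • q ∈ S)
    {a c : ℂ} (hy : a • p + c • r ∈ S) : a = 0 ∨ c = 0 := by
  by_contra! hne
  obtain ⟨ha, hc⟩ := hne
  have h₁ := rowDet_comb p q r 0 1 0 0 0 1 α β 0
  have h₂ := rowDet_comb p q r 0 1 0 0 0 1 a 0 c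
  have h₃ := rowDet_comb p q r 0 1 0 α β 0 a 0 c
  have h₄ := rowDet_comb p q r 0 0 1 α β 0 a 0 c
  simp only [one_smul, zero_smul, add_zero, zero_add] at h₁ h₂ h₃ h₄
  refine absurd (hS q hq r hr _ hx _ hy ?_ ?_ ?_) ?_
  · rw [h₁]; exact mul_ne_zero (by simpa using hα) h
  · rw [h₂]; exact mul_ne_zero (by simpa using ha) h
  · rw [h₃]; exact mul_ne_zero (by simp [hα, hc]) h
  · rw [h₄]; exact mul_ne_zero (by simp [hβ, ha]) h

lemma mem_line_or_eq_smul (hS : NoQuadrangle S) (hp : p ∈ S) (hq : q ∈ S) (hr : r ∈ S)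
    (h : rowDet p q r ≠ 0) (hα : α ≠ 0) (hβ : β ≠ 0) (hx : α • p + β • q ∈ S)
    {y : Fin 3 → ℂ} (hy : y ∈ S) :
    (∃ a b : ℂ, y = a • p + b • q) ∨ ∃ c : ℂ, y = c • r := by
  obtain ⟨a, b, c, rfl⟩ := exists_comb_of_rowDet_ne_zero h y
  have hqp : rowDet q p r ≠ 0 := by
    have h₁ := rowDet_comb p q r 0 1 0 1 0 0 0 0 1
    simp only [one_smul, zero_smul, add_zero, zero_add] at h₁
    rw [h₁]; exact mul_ne_zero (by simp) h
  rcases hS.coord_eq_zero hp hq hr h hy with rfl | rfl | rfl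
  · rw [zero_smul, zero_add] at hy ⊢
    rcases hS.coord_eq_zero_of_mem_line hp hr hqp hβ hα (by rwa [add_comm]) hy with rfl | rfl
    · exact .inr ⟨c, by simp⟩
    · exact .inl ⟨0, b, by simp⟩
  · rw [zero_smul, add_zero] at hy ⊢
    rcases hS.coord_eq_zero_of_mem_line hq hr h hα hβ hx hy with rfl | rfl
    · exact .inr ⟨c, by simp⟩
    · exact .inl ⟨a, 0, by simp⟩
  · exact .inl ⟨a, b, by simp⟩

/-- If a set without quadrangles contains three points on a line and a point `r` off that line,
then every linear automorphism preserving the set fixes `r` projectively. -/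
lemma exists_mulVec_eq_smul (hS : NoQuadrangle S) (hp : p ∈ S) (hq : q ∈ S) (hr : r ∈ S)
    (h : rowDet p q r ≠ 0) (hα : α ≠ 0) (hβ : β ≠ 0) (hx : α • p + β • q ∈ S)
    {M : Matrix (Fin 3) (Fin 3) ℂ} (hM : M.det ≠ 0) (hMS : ∀ u ∈ S, M *ᵥ u ∈ S) :
    ∃ c : ℂ, M *ᵥ r = c • r := by
  have key {u : Fin 3 → ℂ} (hu : u ∈ S) :=
    hS.mem_line_or_eq_smul hp hq hr h hα hβ hx (hMS u hu)
  have line {u w z : Fin 3 → ℂ} (hu : ∃ a b : ℂ, u = a • p + b • q)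
      (hw : ∃ a b : ℂ, w = a • p + b • q) (hz : ∃ a b : ℂ, z = a • p + b • q) :
      rowDet u w z = 0 := by
    obtain ⟨a₁, b₁, rfl⟩ := hu
    obtain ⟨a₂, b₂, rfl⟩ := hw
    obtain ⟨a₃, b₃, rfl⟩ := hz
    simpa using rowDet_comb p q r a₁ b₁ 0 a₂ b₂ 0 a₃ b₃ 0
  have prop {u w z : Fin 3 → ℂ} (hu : ∃ c : ℂ, u = c • r) (hw : ∃ c : ℂ, w = c • r) :
      rowDet u w z = 0 := by
    obtain ⟨c₁, rfl⟩ := hu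
    obtain ⟨c₂, rfl⟩ := hw
    simp only [rowDet_eq, Pi.smul_apply, smul_eq_mul]
    ring
  have h₁ : rowDet (M *ᵥ p) (M *ᵥ q) (M *ᵥ r) ≠ 0 := by
    rw [rowDet_mulVec]; exact mul_ne_zero hM h
  have h₂ : rowDet (M *ᵥ p) (M *ᵥ (α • p + β • q)) (M *ᵥ r) ≠ 0 := by
    have h' := rowDet_comb p q r 1 0 0 α β 0 0 0 1
    simp only [one_smul, zero_smul, add_zero, zero_add] at h'
    rw [rowDet_mulVec, h']
    exact mul_ne_zero hM (mul_ne_zero (by simpa using hβ) h)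
  have h₃ : rowDet (M *ᵥ q) (M *ᵥ (α • p + β • q)) (M *ᵥ r) ≠ 0 := by
    have h' := rowDet_comb p q r 0 1 0 α β 0 0 0 1
    simp only [one_smul, zero_smul, add_zero, zero_add] at h'
    rw [rowDet_mulVec, h']
    exact mul_ne_zero hM (mul_ne_zero (by simpa using hα) h)
  refine (key hr).resolve_left fun hr' => ?_
  rcases key hp with hp' | hp' <;> rcases key hq with hq' | hq'
  · exact h₁ (line hp' hq' hr')
  · rcases key hx with hx' | hx'
    · exact h₂ (line hp' hx' hr')
    · exact h₃ (prop hq' hx')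
  · rcases key hx with hx' | hx'
    · exact h₃ (line hq' hx' hr')
    · exact h₂ (prop hp' hx')
  · exact h₁ (prop hp' hq')

/-- A set without quadrangles that contains a basis and a fourth projective point has a point
fixed by every linear automorphism preserving the set. -/
lemma exists_fixed (hS : NoQuadrangle S) (hp : p ∈ S) (hq : q ∈ S) (hr : r ∈ S)
    (h : rowDet p q r ≠ 0) {x : Fin 3 → ℂ} (hx : x ∈ S) (hxp : ∀ c : ℂ, x ≠ c • p)
    (hxq : ∀ c : ℂ, x ≠ c • q) (hxr : ∀ c : ℂ, x ≠ c • r) :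
    ∃ u : Fin 3 → ℂ, u ≠ 0 ∧ ∀ M : Matrix (Fin 3) (Fin 3) ℂ, M.det ≠ 0 →
      (∀ w ∈ S, M *ᵥ w ∈ S) → ∃ c : ℂ, M *ᵥ u = c • u := by
  obtain ⟨a, b, c, rfl⟩ := exists_comb_of_rowDet_ne_zero h x
  have hqrp : rowDet q r p ≠ 0 := by
    have h' := rowDet_comb p q r 0 1 0 0 0 1 1 0 0
    simp only [one_smul, zero_smul, add_zero, zero_add] at h'
    rw [h']; exact mul_ne_zero (by simp) h
  have hprq : rowDet p r q ≠ 0 := by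
    have h' := rowDet_comb p q r 1 0 0 0 0 1 0 1 0
    simp only [one_smul, zero_smul, add_zero, zero_add] at h'
    rw [h']; exact mul_ne_zero (by simp) h
  have ne_zero {u w z : Fin 3 → ℂ} (h' : rowDet u w z ≠ 0) : z ≠ 0 := by
    rintro rfl
    exact h' (by simp [rowDet_eq])
  rcases hS.coord_eq_zero hp hq hr h hx with rfl | rfl | rfl
  · rw [zero_smul, zero_add] at *
    refine ⟨p, ne_zero hqrp, fun M hM hMS =>
      hS.exists_mulVec_eq_smul hq hr hp hqrp (α := b) (β := c) ?_ ?_ hx hM hMS⟩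
    · rintro rfl; exact hxr c (by simp)
    · rintro rfl; exact hxq b (by simp)
  · rw [zero_smul, add_zero] at *
    refine ⟨q, ne_zero hprq, fun M hM hMS =>
      hS.exists_mulVec_eq_smul hp hr hq hprq (α := a) (β := c) ?_ ?_ hx hM hMS⟩
    · rintro rfl; exact hxr c (by simp)
    · rintro rfl; exact hxp a (by simp)
  · rw [zero_smul, add_zero] at *
    refine ⟨r, ne_zero h, fun M hM hMS =>
      hS.exists_mulVec_eq_smul hp hq hr h (α := a) (β := b) ?_ ?_ hx hM hMS⟩
    · rintro rfl; exact hxq b (by simp)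
    · rintro rfl; exact hxp a (by simp)

end NoQuadrangle

lemma exists_rowDet_ne_zero {p q : Fin 3 → ℂ} (h : LinearIndependent ℂ ![p, q]) :
    ∃ w, rowDet p q w ≠ 0 := by
  by_contra! hw
  refine crossProduct_ne_zero_iff_linearIndependent.mpr h (dotProduct_eq_zero _ fun w => ?_)
  rw [← hw w, dotProduct_comm, triple_product_permutation, triple_product_permutation]
  simp only [rowDet_eq, cross_apply, vec3_dotProduct, cons_val]
  ring

/-- For a linear action of a finite group on `ℂ³`, an orbit contained in a plane but not in a line
forces a projective fixed point. -/
lemma exists_fixed_of_rowDet_eq_zero {G : Type*} [Group G] [Finite G]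
    (ρ : G →* Matrix.GeneralLinearGroup (Fin 3) ℂ) {p q : Fin 3 → ℂ}
    (hpq : LinearIndependent ℂ ![p, q])
    (hp : ∀ g : G, rowDet p q ((ρ g : Matrix (Fin 3) (Fin 3) ℂ) *ᵥ p) = 0)
    (hq : ∀ g : G, rowDet p q ((ρ g : Matrix (Fin 3) (Fin 3) ℂ) *ᵥ q) = 0) :
    ∃ u : Fin 3 → ℂ, u ≠ 0 ∧ ∀ g : G, ∃ c : ℂ,
      (ρ g : Matrix (Fin 3) (Fin 3) ℂ) *ᵥ u = c • u := by
  have := Fintype.ofFinite G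
  obtain ⟨w, hw⟩ := exists_rowDet_ne_zero hpq
  let φ : (Fin 3 → ℂ) →ₗ[ℂ] ℂ :=
    { toFun := rowDet p q
      map_add' := fun x y => by simp [rowDet_eq]; ring
      map_smul' := fun c x => by simp [rowDet_eq]; ring }
  have hφp : φ p = 0 := by simp [φ, rowDet_eq]; ring
  have hφq : φ q = 0 := by simp [φ, rowDet_eq]; ring
  have hφw : φ w ≠ 0 := hw
  let χ : G → ℂ := fun g => φ ((ρ g : Matrix (Fin 3) (Fin 3) ℂ) *ᵥ w) / φ w
  have hχ (g : G) (y : Fin 3 → ℂ) :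
      φ ((ρ g : Matrix (Fin 3) (Fin 3) ℂ) *ᵥ y) = χ g * φ y := by
    obtain ⟨a, b, c, rfl⟩ := exists_comb_of_rowDet_ne_zero hw y
    have h₁ : φ ((ρ g : Matrix (Fin 3) (Fin 3) ℂ) *ᵥ p) = 0 := hp g
    have h₂ : φ ((ρ g : Matrix (Fin 3) (Fin 3) ℂ) *ᵥ q) = 0 := hq g
    simp only [mulVec_add, mulVec_smul, map_add, map_smul, h₁, h₂, hφp, hφq, smul_eq_mul, χ]
    field_simp
    ring
  have hmul (g k : G) : χ (g * k) = χ g * χ k := by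
    apply mul_right_cancel₀ hφw
    rw [← hχ, map_mul, Units.val_mul, ← mulVec_mulVec, hχ, hχ, mul_assoc]
  have hone : χ 1 = 1 := by simp [χ, hφw]
  have hne (g : G) : χ g ≠ 0 := fun h => by simpa [h, hone] using hmul g g⁻¹
  refine ⟨∑ g, (χ g)⁻¹ • ((ρ g : Matrix (Fin 3) (Fin 3) ℂ) *ᵥ w), fun h0 => ?_,
    fun k => ⟨χ k, ?_⟩⟩
  · have h' := congrArg φ h0
    simp [map_sum, hχ, hne, hφw] at h'
  · symm
    rw [mulVec_sum, Finset.smul_sum, ← Equiv.sum_comp (Equiv.mulLeft k)]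
    refine Finset.sum_congr rfl fun g _ => ?_
    rw [Equiv.coe_mulLeft, mulVec_smul, mulVec_mulVec, smul_smul, hmul, map_mul, Units.val_mul,
      mul_inv, mul_inv_cancel_left₀ (hne k)]

lemma linearIndependent_of_rowDet_ne_zero {ι : Type*} {F : ι → Fin 3 → ℂ} {i j k : ι}
    (h : rowDet (F i) (F j) (F k) ≠ 0) (s : Finset ι) (hs : ∀ x ∈ s, x = i ∨ x = j ∨ x = k) :
    LinearIndependent ℂ (fun x : {x // x ∈ s} => F x.1) := by
  have hli : LinearIndependent ℂ ![F i, F j, F k] :=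
    linearIndependent_rows_of_det_ne_zero (A := ![F i, F j, F k]) h
  have hm (x : {x // x ∈ s}) : ∃ m : Fin 3, ![i, j, k] m = x.1 := by
    rcases hs x x.2 with hx | hx | hx
    · exact ⟨0, hx.symm⟩
    · exact ⟨1, hx.symm⟩
    · exact ⟨2, hx.symm⟩
  choose m hm using hm
  have hinj : Function.Injective m := fun x y hxy => Subtype.ext (by rw [← hm x, ← hm y, hxy])
  convert hli.comp m hinj using 1
  ext1 x
  have hF (n : Fin 3) : ![F i, F j, F k] n = F (![i, j, k] n) := by fin_cases n <;> rfl
  rw [Function.comp_apply, hF, hm]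

/-- If a finite group acts on `ℙ²(ℂ)` (via `ρ : G → GL₃(ℂ)`) without fixed points, then any
orbit with at least four distinct points contains four points no three of which are collinear. -/
theorem stmt_0 (G : Type*) [Group G] [Finite G]
    (ρ : G →* Matrix.GeneralLinearGroup (Fin 3) ℂ)
    (hnofix : ¬ ∃ v : Fin 3 → ℂ, v ≠ 0 ∧ ∀ g : G, ∃ c : ℂ,
      (ρ g : Matrix (Fin 3) (Fin 3) ℂ) *ᵥ v = c • v)
    (v : Fin 3 → ℂ) (hv : v ≠ 0)
    (horbit : ∃ g : Fin 4 → G, ∀ i j : Fin 4, i ≠ j → ∀ c : ℂ,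
      (ρ (g i) : Matrix (Fin 3) (Fin 3) ℂ) *ᵥ v ≠
        c • ((ρ (g j) : Matrix (Fin 3) (Fin 3) ℂ) *ᵥ v)) :
    ∃ g : Fin 4 → G, ∀ s : Finset (Fin 4), s.card = 3 →
      LinearIndependent ℂ
        (fun i : {x // x ∈ s} => (ρ (g i.1) : Matrix (Fin 3) (Fin 3) ℂ) *ᵥ v) := by
  obtain ⟨o, ho⟩ := horbit
  let F : G → Fin 3 → ℂ := fun g => (ρ g : Matrix (Fin 3) (Fin 3) ℂ) *ᵥ v
  have hF (g k : G) : (ρ g : Matrix (Fin 3) (Fin 3) ℂ) *ᵥ F k = F (g * k) := by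
    simp [F, mulVec_mulVec]
  have hdet (g : G) : (ρ g : Matrix (Fin 3) (Fin 3) ℂ).det ≠ 0 :=
    ((isUnit_iff_isUnit_det _).mp (ρ g).isUnit).ne_zero
  have hF0 (g : G) : F g ≠ 0 := fun h0 => hv (eq_zero_of_mulVec_eq_zero (hdet g) h0)
  have hpq : LinearIndependent ℂ ![F (o 1), F (o 0)] := by
    rw [LinearIndependent.pair_iff' (hF0 _)]
    exact fun c h0 => ho 0 1 (by decide) c h0.symm
  obtain ⟨r, hr⟩ : ∃ r, rowDet (F (o 1)) (F (o 0)) (F r) ≠ 0 := by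
    by_contra! h
    exact hnofix (exists_fixed_of_rowDet_eq_zero ρ hpq (fun g => by rw [hF, h])
      fun g => by rw [hF, h])
  obtain ⟨i, hi₁, hi₀, hi⟩ : ∃ i : Fin 4, i ≠ 1 ∧ i ≠ 0 ∧ ∀ c : ℂ, F (o i) ≠ c • F r := by
    by_cases h2 : ∀ c : ℂ, F (o 2) ≠ c • F r
    · exact ⟨2, by decide, by decide, h2⟩
    · refine ⟨3, by decide, by decide, fun c hc => ?_⟩
      push Not at h2
      obtain ⟨e, he⟩ := h2
      have hc0 : c ≠ 0 := by
        rintro rfl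
        exact hF0 (o 3) (by simpa using hc)
      refine ho 2 3 (by decide) (e * c⁻¹) (he.trans ?_)
      change e • F r = (e * c⁻¹) • F (o 3)
      rw [hc, smul_smul, inv_mul_cancel_right₀ hc0]
  by_contra hno
  have hS : NoQuadrangle (Set.range F) := by
    rintro _ ⟨g₁, rfl⟩ _ ⟨g₂, rfl⟩ _ ⟨g₃, rfl⟩ _ ⟨g₄, rfl⟩ h₁ h₂ h₃
    by_contra h₄
    refine hno ⟨![g₁, g₂, g₃, g₄], fun s hs => ?_⟩
    obtain ⟨l, hl⟩ : ∃ l, l ∉ s := by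
      by_contra! h
      rw [Finset.eq_univ_iff_forall.mpr h] at hs
      simp at hs
    have hmem (x : Fin 4) (hx : x ∈ s) : x ≠ l := ne_of_mem_of_not_mem hx hl
    let E : Fin 4 → Fin 3 → ℂ := fun i => F (![g₁, g₂, g₃, g₄] i)
    have hcover (i j k : Fin 4) (h : ∀ x, x ≠ l → x = i ∨ x = j ∨ x = k)
        (hd : rowDet (E i) (E j) (E k) ≠ 0) :
        LinearIndependent ℂ (fun x : {x // x ∈ s} => E x.1) :=
      linearIndependent_of_rowDet_ne_zero hd s fun x hx => h x (hmem x hx)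
    clear hl hmem
    fin_cases l
    · exact hcover 1 2 3 (by decide) h₄
    · exact hcover 0 2 3 (by decide) h₃
    · exact hcover 0 1 3 (by decide) h₂
    · exact hcover 0 1 2 (by decide) h₁
  obtain ⟨u, hu, hfix⟩ := hS.exists_fixed ⟨_, rfl⟩ ⟨_, rfl⟩ ⟨_, rfl⟩ hr ⟨o i, rfl⟩
    (ho i 1 hi₁) (ho i 0 hi₀) hi
  refine hnofix ⟨u, hu, fun g => hfix _ (hdet g) ?_⟩
  rintro _ ⟨k, rfl⟩
  exact ⟨g * k, (hF g k).symm⟩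
end

section
/- Let q₁, q₂, q₃ be quadratic forms on ℂ⁴ whose set of common zeros in ℙ³ (the set of lines ℂ·v, v ≠ 0, with q₁(v) = q₂(v) = q₃(v) = 0) is finite. Let 1 ≤ r ≤ 7 and let v₁, …, v_r be nonzero, pairwise non-proportional vectors in ℂ⁴ with qᵢ(v_j) = 0 for all i, j. Then the r points impose independent conditions on quadric surfaces: the linear map sending a quadratic form q on ℂ⁴ to (q(v₁), …, q(v_r)) ∈ ℂʳ is surjective. -/
section QuadricIntersection

variable {K V ι : Type*} [Field K] [AddCommGroup V] [Module K V]

/-- A quadratic form vanishing at three vectors is determined on their span by the three polar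
values. -/
lemma QuadraticForm.map_comb_of_isotropic (Q : QuadraticForm K V) {a b p : V}
    (ha : Q a = 0) (hb : Q b = 0) (hp : Q p = 0) (x y z : K) :
    Q (x • a + y • b + z • p) = x * y * QuadraticMap.polar Q a b
      + x * z * QuadraticMap.polar Q a p + y * z * QuadraticMap.polar Q b p := by
  rw [QuadraticMap.map_add Q, QuadraticMap.map_add Q, QuadraticMap.polar_add_left]
  simp only [QuadraticMap.map_smul, QuadraticMap.polar_smul_left, QuadraticMap.polar_smul_right,
    ha, hb, hp, smul_eq_mul]
  ring

/-- A family of common zeros of quadratic forms with finite common zero locus in projective space,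
indexed by an infinite set, contains two proportional vectors. -/
lemma false_of_infinite_isotropic {q : ι → QuadraticForm K V}
    (hfin : {x : Projectivization K V | ∀ i, q i x.rep = 0}.Finite)
    {f : K → V} {T : Set K} (hT : T.Infinite) (h0 : ∀ t ∈ T, f t ≠ 0)
    (hinj : ∀ t ∈ T, ∀ s ∈ T, ∀ c : K, f t = c • f s → t = s)
    (hq : ∀ t ∈ T, ∀ i, q i (f t) = 0) : False := by
  have : Infinite T := hT.to_subtype
  let g : T → Projectivization K V := fun t => Projectivization.mk K (f t) (h0 t t.2)
  have hg : Function.Injective g := by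
    intro t s hts
    obtain ⟨c, hc⟩ := (Projectivization.mk_eq_mk_iff' K _ _ (h0 t t.2) (h0 s s.2)).1 hts
    exact Subtype.ext (hinj t t.2 s s.2 c hc.symm)
  refine (Set.infinite_range_of_injective hg).mono ?_ hfin
  rintro _ ⟨t, rfl⟩ i
  obtain ⟨c, hc⟩ := Projectivization.exists_smul_eq_mk_rep K (f t) (h0 t t.2)
  change q i (Projectivization.mk K (f t) (h0 t t.2)).rep = 0
  rw [← hc, Units.smul_def, QuadraticMap.map_smul, hq t t.2 i, smul_zero]

/-- A vector outside two subspaces is separated from both of them by a product of two linear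
forms. -/
lemma exists_quadraticForm_of_notMem {W₁ W₂ : Submodule K V} {p : V} (h₁ : p ∉ W₁)
    (h₂ : p ∉ W₂) : ∃ Q : QuadraticForm K V, Q p ≠ 0 ∧ ∀ x, x ∈ W₁ ∨ x ∈ W₂ → Q x = 0 := by
  obtain ⟨l₁, hl₁, hW₁⟩ := Submodule.exists_le_ker_of_notMem h₁
  obtain ⟨l₂, hl₂, hW₂⟩ := Submodule.exists_le_ker_of_notMem h₂
  refine ⟨QuadraticMap.linMulLin l₁ l₂, by simpa using ⟨hl₁, hl₂⟩, ?_⟩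
  rintro x (hx | hx)
  · simp [LinearMap.mem_ker.1 (hW₁ hx)]
  · simp [LinearMap.mem_ker.1 (hW₂ hx)]

variable [Infinite K]

/-- No three points of a finite intersection of quadrics are collinear. -/
lemma notMem_span_pair_of_isotropic {q : ι → QuadraticForm K V}
    (hfin : {x : Projectivization K V | ∀ i, q i x.rep = 0}.Finite) {p a b : V}
    (hp : ∀ i, q i p = 0) (ha : ∀ i, q i a = 0) (hb : ∀ i, q i b = 0)
    (hpa : ∀ c : K, p ≠ c • a) (hpb : ∀ c : K, p ≠ c • b)
    (hab : a ≠ 0 → ∀ c : K, a ≠ c • b) : p ∉ Submodule.span K {a, b} := by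
  rw [Submodule.mem_span_pair]
  rintro ⟨x, y, hxy⟩
  have hx : x ≠ 0 := by
    rintro rfl
    exact hpb y (by rw [← hxy]; simp)
  have hy : y ≠ 0 := by
    rintro rfl
    exact hpa x (by rw [← hxy]; simp)
  have ha0 : a ≠ 0 := by
    rintro rfl
    exact hpb y (by rw [← hxy]; simp)
  have hb0 : b ≠ 0 := by
    rintro rfl
    exact hpa x (by rw [← hxy]; simp)
  have hpol : ∀ i, QuadraticMap.polar (q i) a b = 0 := by
    intro i
    have h := (q i).map_comb_of_isotropic (ha i) (hb i) (hp i) x y 0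
    rw [zero_smul, add_zero, hxy, hp i] at h
    simpa [hx, hy] using h.symm
  refine false_of_infinite_isotropic hfin (f := fun t => a + t • b) Set.infinite_univ ?_ ?_ ?_
  · intro t _ h
    exact hab ha0 (-t) (by rw [neg_smul]; exact eq_neg_of_add_eq_zero_left h)
  · intro t _ s _ c h
    have h1 : (1 - c) • a = (c * s - t) • b := by
      linear_combination (norm := module) h
    have hc : 1 - c = 0 := by
      by_contra hc
      exact hab ha0 ((1 - c)⁻¹ * (c * s - t)) (by rw [mul_smul, ← h1, inv_smul_smul₀ hc])
    rw [hc, zero_smul, eq_comm, smul_eq_zero, or_iff_left hb0] at h1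
    linear_combination -h1 - s * hc
  · intro t _ i
    simpa [hpol i] using (q i).map_comb_of_isotropic (ha i) (hb i) (hp i) 1 t 0

/-- No five points of a finite intersection of quadrics are coplanar. -/
lemma notMem_span_triple_of_isotropic {q : ι → QuadraticForm K V}
    (hfin : {x : Projectivization K V | ∀ i, q i x.rep = 0}.Finite) {p a b c d : V}
    (hp : ∀ i, q i p = 0) (ha : ∀ i, q i a = 0) (hb : ∀ i, q i b = 0)
    (hc : ∀ i, q i c = 0) (hd : ∀ i, q i d = 0)
    (hpab : p ∉ Submodule.span K {a, b}) (hpac : p ∉ Submodule.span K {a, c})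
    (hpbc : p ∉ Submodule.span K {b, c}) (hpad : p ∉ Submodule.span K {a, d})
    (hpbd : p ∉ Submodule.span K {b, d})
    (hab : a ≠ 0 → ∀ k : K, a ≠ k • b) (hcd : c ≠ 0 → ∀ k : K, c ≠ k • d)
    (h₁ : p ∈ Submodule.span K {a, b, c}) : p ∉ Submodule.span K {a, b, d} := by
  intro h₂
  rw [Submodule.mem_span_triple] at h₁ h₂
  rw [Submodule.mem_span_pair] at hpab hpac hpbc hpad hpbd
  obtain ⟨x₁, y₁, z₁, e₁⟩ := h₁
  obtain ⟨x₂, y₂, z₂, e₂⟩ := h₂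
  have hx₁ : x₁ ≠ 0 := by rintro rfl; exact hpbc ⟨y₁, z₁, by rw [← e₁]; simp⟩
  have hy₁ : y₁ ≠ 0 := by rintro rfl; exact hpac ⟨x₁, z₁, by rw [← e₁]; simp⟩
  have hz₁ : z₁ ≠ 0 := by rintro rfl; exact hpab ⟨x₁, y₁, by rw [← e₁]; simp⟩
  have hx₂ : x₂ ≠ 0 := by rintro rfl; exact hpbd ⟨y₂, z₂, by rw [← e₂]; simp⟩
  have hy₂ : y₂ ≠ 0 := by rintro rfl; exact hpad ⟨x₂, z₂, by rw [← e₂]; simp⟩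
  have ha0 : a ≠ 0 := by rintro rfl; exact hpbc ⟨y₁, z₁, by rw [← e₁]; simp⟩
  have hb0 : b ≠ 0 := by rintro rfl; exact hpac ⟨x₁, z₁, by rw [← e₁]; simp⟩
  have hc0 : c ≠ 0 := by rintro rfl; exact hpab ⟨x₁, y₁, by rw [← e₁]; simp⟩
  have hrel : ∀ {x y z : K} {e : V}, x ≠ 0 → y ≠ 0 → x • a + y • b + z • e = p →
      (∀ i, q i e = 0) → ∀ i, QuadraticMap.polar (q i) a b
        = QuadraticMap.polar (q i) a p * y⁻¹ + QuadraticMap.polar (q i) b p * x⁻¹ := by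
    intro x y z e hx hy he hqe i
    have h := (q i).map_comb_of_isotropic (ha i) (hb i) (hp i) (-x) (-y) 1
    have h' : -x • a + -y • b + (1 : K) • p = z • e := by rw [← he]; module
    rw [h', QuadraticMap.map_smul, hqe i, smul_zero] at h
    field_simp
    linear_combination -h
  have hrel₁ := hrel hx₁ hy₁ e₁ hc
  have hrel₂ := hrel hx₂ hy₂ e₂ hd
  have hne : ¬(x₁⁻¹ = x₂⁻¹ ∧ y₁⁻¹ = y₂⁻¹) := by
    rintro ⟨hx, hy⟩
    rw [inv_inj] at hx hy
    subst hx hy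
    have h : z₁ • c = z₂ • d := add_left_cancel (e₁.trans e₂.symm)
    exact hcd hc0 (z₁⁻¹ * z₂) (by rw [mul_smul, ← h, inv_smul_smul₀ hz₁])
  have hu₁ := inv_ne_zero hx₁
  have hv₁ := inv_ne_zero hy₁
  generalize x₁⁻¹ = u₁ at *
  generalize y₁⁻¹ = v₁ at *
  generalize x₂⁻¹ = u₂ at *
  generalize y₂⁻¹ = v₂ at *
  -- The line through `(u₁, v₁)` and `(u₂, v₂)` maps to a conic in the span of `a`, `b`, `p`.
  let u : K → K := fun t => u₁ + t * (u₂ - u₁)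
  let v : K → K := fun t => v₁ + t * (v₂ - v₁)
  have hT : {t : K | u t ≠ 0 ∧ v t ≠ 0}.Infinite := by
    have hfin' : ({-u₁ / (u₂ - u₁), -v₁ / (v₂ - v₁)} : Set K).Finite := Set.toFinite _
    refine hfin'.infinite_compl.mono fun t ht => ?_
    have hroot : ∀ {m n : K}, m ≠ 0 → m + t * n = 0 → t = -m / n := by
      intro m n hm h
      have hn : n ≠ 0 := by rintro rfl; exact hm (by simpa using h)
      rw [eq_div_iff hn]
      linear_combination h
    exact ⟨fun h => ht (Or.inl (hroot hu₁ h)), fun h => ht (Or.inr (hroot hv₁ h))⟩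
  have hindep : ∀ x y z : K, x • a + y • b + z • p = 0 → x = 0 ∧ y = 0 ∧ z = 0 := by
    intro x y z h
    have hz : z = 0 := by
      by_contra hz
      refine hpab ⟨-(z⁻¹ * x), -(z⁻¹ * y), ?_⟩
      have h' : z⁻¹ • (x • a + y • b + z • p) = 0 := by rw [h, smul_zero]
      rw [smul_add, inv_smul_smul₀ hz] at h'
      rw [← neg_eq_of_add_eq_zero_right h']
      module
    subst hz
    have hx : x = 0 := by
      by_contra hx
      refine hab ha0 (-(x⁻¹ * y)) ?_
      have h' : x⁻¹ • (x • a + y • b + (0 : K) • p) = 0 := by rw [h, smul_zero]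
      rw [zero_smul, add_zero, smul_add, inv_smul_smul₀ hx] at h'
      rw [eq_neg_of_add_eq_zero_left h']
      module
    subst hx
    simpa [hb0] using h
  refine false_of_infinite_isotropic hfin
    (f := fun t => (-v t) • a + (-u t) • b + (u t * v t) • p) hT ?_ ?_ ?_
  · intro t ht h
    exact ht.1 (neg_eq_zero.1 (hindep _ _ _ h).2.1)
  · intro t ht s hs k h
    obtain ⟨h1, h2, h3⟩ := hindep (-v t + k * v s) (-u t + k * u s) (u t * v t - k * (u s * v s))
      (by rw [← sub_eq_zero] at h; rw [← h]; module)
    have hk0 : k ≠ 0 := by rintro rfl; exact ht.1 (by linear_combination -h2)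
    have hk : k = 1 := by
      have : k * (u s * v s) * (k - 1) = 0 := by
        linear_combination h3 + k * v s * h2 + u t * h1
      simpa [hk0, hs.1, hs.2, sub_eq_zero] using this
    subst hk
    by_contra hts
    have hts' := sub_ne_zero.2 hts
    refine hne ⟨?_, ?_⟩
    · refine mul_left_cancel₀ hts' ?_
      linear_combination h2
    · refine mul_left_cancel₀ hts' ?_
      linear_combination h1
  · intro t _ i
    rw [(q i).map_comb_of_isotropic (ha i) (hb i) (hp i)]
    linear_combination u t * v t * ((1 - t) * hrel₁ i + t * hrel₂ i)

/-- A point of a finite intersection of quadrics is separated by a quadric from any six others;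
zero vectors are allowed among the latter. -/
lemma exists_quadraticForm_separating {q : ι → QuadraticForm K V}
    (hfin : {x : Projectivization K V | ∀ i, q i x.rep = 0}.Finite) {p : V} {u : Fin 6 → V}
    (hp : ∀ i, q i p = 0) (hu : ∀ j i, q i (u j) = 0) (hpu : ∀ j, ∀ c : K, p ≠ c • u j)
    (huu : ∀ j k, j ≠ k → u j ≠ 0 → ∀ c : K, u j ≠ c • u k) :
    ∃ Q : QuadraticForm K V, Q p ≠ 0 ∧ ∀ j, Q (u j) = 0 := by
  have h2 : ∀ j k, j ≠ k → p ∉ Submodule.span K {u j, u k} := fun j k hjk =>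
    notMem_span_pair_of_isotropic hfin hp (hu j) (hu k) (hpu j) (hpu k) (huu j k hjk)
  have h3 : ∀ i j k l, i ≠ j → i ≠ k → i ≠ l → j ≠ k → j ≠ l → k ≠ l →
      p ∈ Submodule.span K {u i, u j, u k} → p ∉ Submodule.span K {u i, u j, u l} :=
    fun i j k l hij hik hil hjk hjl hkl =>
      notMem_span_triple_of_isotropic hfin hp (hu i) (hu j) (hu k) (hu l) (h2 i j hij) (h2 i k hik)
        (h2 j k hjk) (h2 i l hil) (h2 j l hjl) (huu i j hij) (huu k l hkl)
  have key : ∀ i j k l m n : Fin 6, (∀ x : Fin 6, x = i ∨ x = j ∨ x = k ∨ x = l ∨ x = m ∨ x = n) →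
      p ∉ Submodule.span K {u i, u j, u k} → p ∉ Submodule.span K {u l, u m, u n} →
      ∃ Q : QuadraticForm K V, Q p ≠ 0 ∧ ∀ j, Q (u j) = 0 := by
    intro i j k l m n hall hW₁ hW₂
    obtain ⟨Q, hQp, hQ⟩ := exists_quadraticForm_of_notMem hW₁ hW₂
    refine ⟨Q, hQp, fun x => hQ _ ?_⟩
    rcases hall x with rfl | rfl | rfl | rfl | rfl | rfl
    · exact Or.inl (Submodule.subset_span (by simp))
    · exact Or.inl (Submodule.subset_span (by simp))
    · exact Or.inl (Submodule.subset_span (by simp))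
    · exact Or.inr (Submodule.subset_span (by simp))
    · exact Or.inr (Submodule.subset_span (by simp))
    · exact Or.inr (Submodule.subset_span (by simp))
  by_contra hno
  have k₁ := fun h h' => hno (key 0 1 2 4 5 3 (by decide) h h')
  have k₂ := fun h h' => hno (key 0 1 3 4 5 2 (by decide) h h')
  have k₃ := fun h h' => hno (key 0 1 4 3 5 2 (by decide) h h')
  have a₁ := h3 0 1 2 3 (by decide) (by decide) (by decide) (by decide) (by decide) (by decide)
  have a₂ := h3 0 1 2 4 (by decide) (by decide) (by decide) (by decide) (by decide) (by decide)
  have a₃ := h3 0 1 3 4 (by decide) (by decide) (by decide) (by decide) (by decide) (by decide)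
  have b₁ := h3 4 5 3 2 (by decide) (by decide) (by decide) (by decide) (by decide) (by decide)
  have b₂ := h3 5 2 4 3 (by decide) (by decide) (by decide) (by decide) (by decide) (by decide)
  have b₃ := h3 3 5 4 2 (by decide) (by decide) (by decide) (by decide) (by decide) (by decide)
  have s₁ : ({u 5, u 2, u 4} : Set V) = {u 4, u 5, u 2} := by
    rw [Set.pair_comm, Set.insert_comm]
  have s₂ : ({u 5, u 2, u 3} : Set V) = {u 3, u 5, u 2} := by
    rw [Set.pair_comm, Set.insert_comm]
  have s₃ : ({u 3, u 5, u 4} : Set V) = {u 4, u 5, u 3} := by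
    rw [Set.pair_comm, Set.insert_comm, Set.pair_comm, Set.insert_comm, Set.pair_comm,
      Set.insert_comm]
  rw [s₁, s₂] at b₂
  rw [s₃] at b₃
  generalize (p ∈ Submodule.span K {u 0, u 1, u 2}) = P₁ at *
  generalize (p ∈ Submodule.span K {u 0, u 1, u 3}) = P₂ at *
  generalize (p ∈ Submodule.span K {u 0, u 1, u 4}) = P₃ at *
  generalize (p ∈ Submodule.span K {u 4, u 5, u 3}) = R₁ at *
  generalize (p ∈ Submodule.span K {u 4, u 5, u 2}) = R₂ at *
  generalize (p ∈ Submodule.span K {u 3, u 5, u 2}) = R₃ at *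
  clear h3 h2 key hno s₁ s₂ s₃ hp hu hpu huu hfin
  tauto

end QuadricIntersection

/-- At most seven distinct points of `ℙ³` lying on a zero-dimensional intersection of three
quadrics impose independent conditions on quadric surfaces. -/
theorem stmt_3 (q₁ q₂ q₃ : QuadraticForm ℂ (Fin 4 → ℂ))
    (hfin : {x : Projectivization ℂ (Fin 4 → ℂ) |
      q₁ x.rep = 0 ∧ q₂ x.rep = 0 ∧ q₃ x.rep = 0}.Finite)
    (r : ℕ) (hr1 : 1 ≤ r) (hr7 : r ≤ 7)
    (v : Fin r → (Fin 4 → ℂ))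
    (hv0 : ∀ i, v i ≠ 0)
    (hvp : ∀ i j : Fin r, i ≠ j → ∀ c : ℂ, v j ≠ c • v i)
    (hvanish : ∀ i, q₁ (v i) = 0 ∧ q₂ (v i) = 0 ∧ q₃ (v i) = 0) :
    ∀ w : Fin r → ℂ, ∃ q : QuadraticForm ℂ (Fin 4 → ℂ), ∀ i, q (v i) = w i := by
  let q : Fin 3 → QuadraticForm ℂ (Fin 4 → ℂ) := ![q₁, q₂, q₃]
  have hq : ∀ x, (∀ i, q i x = 0) ↔ q₁ x = 0 ∧ q₂ x = 0 ∧ q₃ x = 0 := by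
    intro x
    simp [q, Fin.forall_fin_succ]
  have hfin' : {x : Projectivization ℂ (Fin 4 → ℂ) | ∀ i, q i x.rep = 0}.Finite := by
    simpa only [hq] using hfin
  let V : Fin 7 → (Fin 4 → ℂ) := fun j => if h : (j : ℕ) < r then v ⟨j, h⟩ else 0
  have hVv : ∀ i : Fin r, V (Fin.castLE hr7 i) = v i := fun i => by simp [V]
  have hVq : ∀ j i, q i (V j) = 0 := by
    intro j
    by_cases h : (j : ℕ) < r
    · simpa [V, h] using (hq _).2 (hvanish ⟨j, h⟩)
    · simp [V, h]
  have hVp : ∀ j k, j ≠ k → V j ≠ 0 → ∀ c : ℂ, V j ≠ c • V k := by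
    intro j k hjk hj c
    by_cases h : (j : ℕ) < r
    · by_cases h' : (k : ℕ) < r
      · have hne : (⟨k, h'⟩ : Fin r) ≠ ⟨j, h⟩ := by
          simpa [Fin.ext_iff, eq_comm] using hjk
        simpa [V, h, h'] using hvp _ _ hne c
      · simpa [V, h, h'] using hv0 ⟨j, h⟩
    · simp [V, h] at hj
  have hsep : ∀ i : Fin r, ∃ Q : QuadraticForm ℂ (Fin 4 → ℂ),
      Q (v i) ≠ 0 ∧ ∀ j, j ≠ i → Q (v j) = 0 := by
    intro i
    let p : Fin 7 := Fin.castLE hr7 i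
    have hp0 : V p ≠ 0 := by rw [hVv]; exact hv0 i
    obtain ⟨Q, hQp, hQ⟩ := exists_quadraticForm_separating hfin' (p := V p)
      (u := fun j => V (p.succAbove j)) (hVq p) (fun j => hVq _)
      (fun j => hVp _ _ (Fin.succAbove_ne p j).symm hp0)
      (fun j k hjk => hVp _ _ (fun h => hjk (Fin.succAbove_right_injective h)))
    refine ⟨Q, by rwa [← hVv i], fun j hj => ?_⟩
    obtain ⟨k, hk⟩ := Fin.exists_succAbove_eq (x := Fin.castLE hr7 j) (y := p)
      (fun h => hj (Fin.castLE_injective hr7 h))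
    rw [← hVv j, ← hk]
    exact hQ k
  choose Q hQi hQj using hsep
  intro w
  refine ⟨∑ i, (w i / Q i (v i)) • Q i, fun j => ?_⟩
  rw [sum_apply, Finset.sum_eq_single j]
  · simp [hQi j]
  · intro i _ hij
    simp [hQj i j hij.symm]
  · simp
end

section
/- Let q₁, q₂, q₃ be quadratic forms on ℂ⁴ and let v₁, …, v₈ be nonzero, pairwise non-proportional vectors in ℂ⁴ such that the set of common zeros of q₁, q₂, q₃ in ℙ³ is exactly the eight distinct points [v₁], …, [v₈] (so the eight points form a zero-dimensional complete intersection of three quadric surfaces). Then the eight points do not impose independent conditions on quadric surfaces: the linear map sending a quadratic form q on ℂ⁴ to (q(v₁), …, q(v₈)) ∈ ℂ⁸ is not surjective. -/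
/-- A quadratic form over `ℂ` has a nontrivial zero among the linear combinations of any two
vectors. -/
theorem QuadraticForm.exists_isotropic_of_pair {V : Type*} [AddCommGroup V] [Module ℂ V]
    (Q : QuadraticForm ℂ V) (a b : V) :
    ∃ x y : ℂ, (x ≠ 0 ∨ y ≠ 0) ∧ Q (x • a + y • b) = 0 := by
  by_cases ha : Q a = 0
  · exact ⟨1, 0, by simp, by simpa using ha⟩
  · obtain ⟨s, hs⟩ := IsAlgClosed.exists_pow_nat_eq
      (discrim (Q a) (QuadraticMap.polar Q a b) (Q b)) (n := 2) (by norm_num)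
    obtain ⟨x, hx⟩ := exists_quadratic_eq_zero ha ⟨s, by rw [← hs, sq]⟩
    refine ⟨x, 1, by simp, ?_⟩
    rw [QuadraticMap.map_add Q, QuadraticMap.map_smul, one_smul, QuadraticMap.polar_smul_left]
    simp only [smul_eq_mul]
    linear_combination hx

/-- A degenerate ternary quadratic form over `ℂ` has a nontrivial common zero with any other
ternary quadratic form. -/
theorem QuadraticForm.exists_common_zero_of_degenerate {V : Type*} [AddCommGroup V] [Module ℂ V]
    (hV : Module.finrank ℂ V = 3) (Q R : QuadraticForm ℂ V) {e : V} (he : e ≠ 0)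
    (hQ : ∀ x, QuadraticMap.polar Q e x = 0) :
    ∃ x ≠ 0, Q x = 0 ∧ R x = 0 := by
  have hQe : Q e = 0 := by
    have := hQ e
    rw [QuadraticMap.polar_self] at this
    simpa using this
  obtain ⟨a, ha⟩ := exists_linearIndependent_pair_of_one_lt_finrank (R := ℂ) (by omega) he
  obtain ⟨b, hb⟩ : ∃ b, b ∉ Submodule.span ℂ (Set.range ![e, a]) := by
    by_contra! h
    have h1 : Submodule.span ℂ (Set.range ![e, a]) = ⊤ := by
      ext x; simpa using h x
    have h2 := finrank_span_eq_card ha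
    rw [h1, finrank_top, hV] at h2
    simp at h2
  have hlin : LinearIndependent ℂ ![b, e, a] := linearIndependent_finCons.2 ⟨ha, hb⟩
  obtain ⟨x, y, hxy, hu⟩ := Q.exists_isotropic_of_pair a b
  obtain ⟨s, t, hst, hw⟩ := R.exists_isotropic_of_pair (x • a + y • b) e
  refine ⟨_, ?_, ?_, hw⟩
  · intro h0
    have h := Fintype.linearIndependent_iff.1 hlin ![s * y, t, s * x] (by
      simp only [Fin.sum_univ_three, Matrix.cons_val]
      rw [← h0]; module)
    have h1 : s * y = 0 := by simpa using h 0
    have h2 : t = 0 := by simpa using h 1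
    have h3 : s * x = 0 := by simpa using h 2
    grind
  · rw [QuadraticMap.map_add Q, QuadraticMap.map_smul, QuadraticMap.map_smul, hu, hQe,
      QuadraticMap.polar_comm, QuadraticMap.polar_smul_left, hQ]
    simp

/-- Some member of a pencil of quadratic forms over `ℂ` is degenerate. -/
theorem QuadraticForm.exists_degenerate_of_pencil {V : Type*} [AddCommGroup V] [Module ℂ V]
    [FiniteDimensional ℂ V] [Nontrivial V] (Q R : QuadraticForm ℂ V) :
    ∃ e ≠ 0, (∀ x, QuadraticMap.polar R e x = 0) ∨
      ∃ t : ℂ, ∀ x, QuadraticMap.polar (Q - t • R) e x = 0 := by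
  by_cases hR : Function.Injective (QuadraticMap.polarBilin R)
  · let f : V ≃ₗ[ℂ] Module.Dual ℂ V := LinearEquiv.ofInjectiveOfFinrankEq _ hR
      Subspace.dual_finrank_eq.symm
    obtain ⟨t, ht⟩ := Module.End.exists_eigenvalue
      (f.symm.toLinearMap ∘ₗ (QuadraticMap.polarBilin Q : V →ₗ[ℂ] Module.Dual ℂ V))
    obtain ⟨e, he⟩ := ht.exists_hasEigenvector
    refine ⟨e, he.2, Or.inr ⟨t, fun x => ?_⟩⟩
    have h1 := congrArg f he.apply_eq_smul
    simp only [LinearMap.comp_apply, LinearEquiv.coe_coe, LinearEquiv.apply_symm_apply,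
      map_smul] at h1
    have h2 : QuadraticMap.polar Q e x = t * QuadraticMap.polar R e x :=
      LinearMap.congr_fun h1 x
    simp only [QuadraticMap.polar, sub_apply, smul_apply,
      smul_eq_mul] at h2 ⊢
    linear_combination h2
  · rw [← LinearMap.ker_eq_bot, Submodule.eq_bot_iff] at hR
    push Not at hR
    obtain ⟨e, he, he0⟩ := hR
    exact ⟨e, he0, Or.inl fun x => LinearMap.congr_fun (LinearMap.mem_ker.1 he) x⟩

/-- Two plane conics over `ℂ` meet. -/
theorem QuadraticForm.exists_common_zero_of_finrank_eq_three {V : Type*} [AddCommGroup V]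
    [Module ℂ V] (hV : Module.finrank ℂ V = 3) (Q R : QuadraticForm ℂ V) :
    ∃ x ≠ 0, Q x = 0 ∧ R x = 0 := by
  have : FiniteDimensional ℂ V := Module.finite_of_finrank_pos (by omega)
  have : Nontrivial V := Module.nontrivial_of_finrank_pos (R := ℂ) (by omega)
  obtain ⟨e, he, h | ⟨t, h⟩⟩ := Q.exists_degenerate_of_pencil R
  · obtain ⟨x, hx, h1, h2⟩ := exists_common_zero_of_degenerate hV R Q he h
    exact ⟨x, hx, h2, h1⟩
  · obtain ⟨x, hx, h1, h2⟩ := exists_common_zero_of_degenerate hV (Q - t • R) R he h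
    refine ⟨x, hx, ?_, h2⟩
    simpa [h2] using h1

/-- The space of quadratic forms in `n` variables has dimension at most `n (n + 1) / 2`. -/
theorem QuadraticForm.finite_and_finrank_le (n : ℕ) :
    Module.Finite ℂ (QuadraticForm ℂ (Fin n → ℂ)) ∧
      Module.finrank ℂ (QuadraticForm ℂ (Fin n → ℂ)) ≤ (n + 1).choose 2 := by
  let F : QuadraticForm ℂ (Fin n → ℂ) →ₗ[ℂ] (Sym2 (Fin n) → ℂ) :=
    { toFun := fun q => Sym2.lift
        ⟨fun i j => QuadraticMap.polar q (Pi.single i 1) (Pi.single j 1),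
          fun i j => QuadraticMap.polar_comm _ _ _⟩
      map_add' := fun p q => by
        ext z
        induction z with
        | _ i j => simp [QuadraticMap.polar_add]
      map_smul' := fun c q => by
        ext z
        induction z with
        | _ i j => simp [QuadraticMap.polar_smul] }
  have hF : Function.Injective F := by
    intro p q h
    have hpq : QuadraticMap.polarBilin p = QuadraticMap.polarBilin q := by
      refine LinearMap.ext_basis (Pi.basisFun ℂ (Fin n)) (Pi.basisFun ℂ (Fin n)) fun i j => ?_
      simpa [F] using congrFun h s(i, j)
    ext x
    have hx : QuadraticMap.polar p x x = QuadraticMap.polar q x x :=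
      LinearMap.congr_fun (LinearMap.congr_fun hpq x) x
    simpa [QuadraticMap.polar_self] using hx
  refine ⟨Module.Finite.of_injective F hF, ?_⟩
  have := LinearMap.finrank_le_finrank_of_injective hF
  simpa [Sym2.card] using this

/-- If eight points impose independent conditions on quadric surfaces, then any three quadratic
forms vanishing at them are linearly dependent. -/
theorem QuadraticForm.not_linearIndependent_of_surjective (v : Fin 8 → (Fin 4 → ℂ))
    (hsurj : ∀ w : Fin 8 → ℂ, ∃ q : QuadraticForm ℂ (Fin 4 → ℂ), ∀ i, q (v i) = w i)
    (p : Fin 3 → QuadraticForm ℂ (Fin 4 → ℂ)) (hp : ∀ j i, p j (v i) = 0) :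
    ¬ LinearIndependent ℂ p := by
  intro hlin
  obtain ⟨hfin, hrank⟩ := finite_and_finrank_le 4
  let ev : QuadraticForm ℂ (Fin 4 → ℂ) →ₗ[ℂ] (Fin 8 → ℂ) :=
    { toFun := fun q i => q (v i)
      map_add' := fun _ _ => rfl
      map_smul' := fun _ _ => rfl }
  have hev : Function.Surjective ev := fun w => (hsurj w).imp fun q h => funext h
  have h1 := ev.finrank_range_add_finrank_ker
  rw [LinearMap.range_eq_top.2 hev, finrank_top, Module.finrank_fin_fun] at h1
  have h2 : Submodule.span ℂ (Set.range p) ≤ LinearMap.ker ev := by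
    rw [Submodule.span_le]
    rintro _ ⟨j, rfl⟩
    exact LinearMap.mem_ker.2 (funext (hp j))
  have h3 := Submodule.finrank_mono h2
  rw [finrank_span_eq_card hlin, Fintype.card_fin] at h3
  have h4 : (4 + 1).choose 2 = 10 := rfl
  omega

/-- Two quadric surfaces in `ℙ³` over `ℂ` have a common point off any nonempty finite set of
points. -/
theorem QuadraticForm.exists_common_zero_notMem {ι : Type*} [Finite ι] [Nonempty ι]
    (Q R : QuadraticForm ℂ (Fin 4 → ℂ)) (v : ι → (Fin 4 → ℂ)) (hv : ∀ i, v i ≠ 0) :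
    ∃ x ≠ 0, Q x = 0 ∧ R x = 0 ∧ ∀ i (c : ℂ), v i ≠ c • x := by
  obtain ⟨f, hf⟩ := Module.exists_dual_forall_apply_ne_zero (K := ℂ) v hv
  have hf0 : f ≠ 0 := fun h => hf (Classical.arbitrary ι) (by simp [h])
  have hrank : Module.finrank ℂ (LinearMap.ker f) = 3 := by
    have := Module.Dual.finrank_ker_add_one_of_ne_zero hf0
    rw [Module.finrank_fin_fun] at this
    omega
  obtain ⟨x, hx, h1, h2⟩ := exists_common_zero_of_finrank_eq_three hrank
    (Q.comp (LinearMap.ker f).subtype) (R.comp (LinearMap.ker f).subtype)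
  refine ⟨x, by simpa using hx, h1, h2, fun i c h => hf i ?_⟩
  rw [h, map_smul, LinearMap.mem_ker.1 x.2, smul_zero]

/-- Eight distinct points of `ℙ³` forming a zero-dimensional complete intersection of three
quadric surfaces do not impose independent conditions on quadric surfaces. -/
theorem stmt_4 (q₁ q₂ q₃ : QuadraticForm ℂ (Fin 4 → ℂ))
    (v : Fin 8 → (Fin 4 → ℂ))
    (hv0 : ∀ i, v i ≠ 0)
    (hvp : ∀ i j : Fin 8, i ≠ j → ∀ c : ℂ, v j ≠ c • v i)
    (hzeros : {x : Projectivization ℂ (Fin 4 → ℂ) |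
        q₁ x.rep = 0 ∧ q₂ x.rep = 0 ∧ q₃ x.rep = 0}
      = Set.range (fun i : Fin 8 => Projectivization.mk ℂ (v i) (hv0 i))) :
    ¬ ∀ w : Fin 8 → ℂ, ∃ q : QuadraticForm ℂ (Fin 4 → ℂ), ∀ i, q (v i) = w i := by
  intro hsurj
  have hq : ∀ i, q₁ (v i) = 0 ∧ q₂ (v i) = 0 ∧ q₃ (v i) = 0 := fun i => by
    have hmem : Projectivization.mk ℂ (v i) (hv0 i) ∈ {x : Projectivization ℂ (Fin 4 → ℂ) |
        q₁ x.rep = 0 ∧ q₂ x.rep = 0 ∧ q₃ x.rep = 0} := by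
      rw [hzeros]; exact ⟨i, rfl⟩
    obtain ⟨a, ha⟩ := Projectivization.exists_smul_eq_mk_rep ℂ (v i) (hv0 i)
    simp only [Set.mem_ofPred_eq, ← ha, Units.smul_def, QuadraticMap.map_smul] at hmem
    simpa using hmem
  have hnone : ∀ x ≠ 0, q₁ x = 0 → q₂ x = 0 → q₃ x = 0 → ∃ i, ∃ c : ℂ, v i = c • x := by
    intro x hx h1 h2 h3
    have hmem : Projectivization.mk ℂ x hx ∈
        Set.range (fun i : Fin 8 => Projectivization.mk ℂ (v i) (hv0 i)) := by
      rw [← hzeros]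
      obtain ⟨a, ha⟩ := Projectivization.exists_smul_eq_mk_rep ℂ x hx
      simp [← ha, Units.smul_def, QuadraticMap.map_smul, h1, h2, h3]
    obtain ⟨i, hi⟩ := hmem
    obtain ⟨c, hc⟩ := (Projectivization.mk_eq_mk_iff' ℂ _ _ _ _).1 hi
    exact ⟨i, c, hc.symm⟩
  have hdep := QuadraticForm.not_linearIndependent_of_surjective v hsurj ![q₁, q₂, q₃] fun j i => by
    fin_cases j
    exacts [(hq i).1, (hq i).2.1, (hq i).2.2]
  obtain ⟨g, hg, j, hj⟩ := Fintype.not_linearIndependent_iff.1 hdep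
  have hrel : ∀ x, g 0 * q₁ x + g 1 * q₂ x + g 2 * q₃ x = 0 := fun x => by
    have h := congrArg (fun q : QuadraticForm ℂ (Fin 4 → ℂ) => q x) hg
    simpa [Fin.sum_univ_three] using h
  fin_cases j
  · obtain ⟨x, hx, h2, h3, h⟩ := QuadraticForm.exists_common_zero_notMem q₂ q₃ v hv0
    have hx' : g 0 = 0 ∨ q₁ x = 0 := by simpa [h2, h3] using hrel x
    obtain ⟨i, c, hc⟩ := hnone x hx (hx'.resolve_left hj) h2 h3
    exact h i c hc
  · obtain ⟨x, hx, h1, h3, h⟩ := QuadraticForm.exists_common_zero_notMem q₁ q₃ v hv0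
    have hx' : g 1 = 0 ∨ q₂ x = 0 := by simpa [h1, h3] using hrel x
    obtain ⟨i, c, hc⟩ := hnone x hx h1 (hx'.resolve_left hj) h3
    exact h i c hc
  · obtain ⟨x, hx, h1, h2, h⟩ := QuadraticForm.exists_common_zero_notMem q₁ q₂ v hv0
    have hx' : g 2 = 0 ∨ q₃ x = 0 := by simpa [h1, h2] using hrel x
    obtain ⟨i, c, hc⟩ := hnone x hx h1 h2 (hx'.resolve_left hj)
    exact h i c hc
end

section
/- Let v₁, …, v₇ be nonzero, pairwise non-proportional vectors in ℂ⁴ such that the space L of quadratic forms on ℂ⁴ vanishing at all of v₁, …, v₇ has dimension 3 (the net of quadrics through the seven points), and let A₀, A₁, A₂ be symmetric 4×4 complex matrices whose associated quadratic forms form a basis of L. Then the following are equivalent: (a) every nonzero member of L has matrix rank at least 3 (every quadric of the net is irreducible) and the set of common zeros of L in ℙ³ consists of exactly 8 distinct points (the seven points form an Aronhold heptad); (b) the Hessian quartic det(x·A₀ + y·A₁ + z·A₂) ∈ ℂ[x,y,z] is a smooth quartic form, i.e., there is no nonzero (x,y,z) ∈ ℂ³ at which it and all three of its partial derivatives vanish.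 -/
open Matrix MvPolynomial

theorem Derivation.apply_prod {k R ι : Type*} [CommRing k] [CommRing R] [Algebra k R]
    [DecidableEq ι] (D : Derivation k R R) (s : Finset ι) (f : ι → R) :
    D (∏ i ∈ s, f i) = ∑ i ∈ s, ∏ j ∈ s, Function.update f i (D (f i)) j := by
  induction s using Finset.induction_on with
  | empty => simp
  | insert a s ha ih =>
    rw [Finset.prod_insert ha, D.leibniz, ih, Finset.sum_insert ha, Finset.prod_insert ha,
      Function.update_self, smul_eq_mul, smul_eq_mul, add_comm, mul_comm (D (f a)), Finset.mul_sum]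
    congr 1
    · rw [mul_comm, mul_comm (D (f a))]
      congr 1
      exact Finset.prod_congr rfl fun j hj =>
        (Function.update_of_ne (ne_of_mem_of_not_mem hj ha) _ _).symm
    · refine Finset.sum_congr rfl fun i hi => ?_
      rw [Finset.prod_insert ha, Function.update_of_ne (ne_of_mem_of_not_mem hi ha).symm]

theorem Derivation.apply_det {k R n : Type*} [CommRing k] [CommRing R] [Algebra k R]
    [Fintype n] [DecidableEq n] (D : Derivation k R R) (M : Matrix n n R) :
    D M.det = (M.adjugate * M.map D).trace := by
  have h : D M.det = ∑ j, (M.updateCol j fun i => D (M i j)).det := by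
    simp only [det_apply, map_sum, map_zsmul, Units.smul_def, D.apply_prod]
    rw [Finset.sum_comm]
    refine Finset.sum_congr rfl fun σ _ => ?_
    rw [Finset.smul_sum]
    refine Finset.sum_congr rfl fun i _ => ?_
    congr 1
    refine Finset.prod_congr rfl fun j _ => ?_
    by_cases hj : j = i
    · subst hj; simp
    · simp [hj]
  rw [h]
  simp only [trace, diag, mul_apply, ← cramer_apply, cramer_eq_adjugate_mulVec, mulVec, dotProduct,
    map_apply]

section adj
variable {K : Type*} [Field K]

theorem finrank_ker_mulVecLin {m n : ℕ} (N : Matrix (Fin m) (Fin n) K) :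
    N.rank + Module.finrank K (LinearMap.ker N.mulVecLin) = n := by
  simpa [Matrix.rank] using N.mulVecLin.finrank_range_add_finrank_ker

theorem exists_ker_of_rank {n : ℕ} {N : Matrix (Fin n) (Fin n) K} (h : N.rank + 2 ≤ n)
    (f : (Fin n → K) →ₗ[K] K) :
    ∃ u ≠ 0, N *ᵥ u = 0 ∧ f u = 0 := by
  have h1 := finrank_ker_mulVecLin N
  obtain ⟨x, hx, hx0⟩ := (Submodule.ne_bot_iff _).1
    (LinearMap.ker_ne_bot_of_finrank_lt (f := f ∘ₗ (LinearMap.ker N.mulVecLin).subtype)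
      (by rw [Module.finrank_self]; omega))
  refine ⟨x, by simpa using hx0, LinearMap.mem_ker.1 x.2, by simpa using hx⟩

theorem adjugate_eq_zero_of_rank {n : ℕ} {N : Matrix (Fin n) (Fin n) K} (h : N.rank + 2 ≤ n) :
    N.adjugate = 0 := by
  ext i j
  obtain ⟨u, hu0, hu, hi⟩ := exists_ker_of_rank h (LinearMap.proj i)
  rw [adjugate_apply]
  refine exists_mulVec_eq_zero_iff.1 ⟨u, hu0, ?_⟩
  ext k
  by_cases hk : k = j
  · subst hk; simpa [mulVec] using hi
  · simpa [mulVec, hk] using congrFun hu k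

theorem adjugate_ne_zero_of_rank {n : ℕ} [NeZero n] {N : Matrix (Fin n) (Fin n) K}
    (h : n ≤ N.rank + 1) :
    N.adjugate ≠ 0 := by
  intro hadj
  have hdet : N.det = 0 := by
    have := congrFun (congrFun (mul_adjugate N) 0) 0
    simpa [hadj] using this.symm
  obtain ⟨u, hu0, hu⟩ := exists_mulVec_eq_zero_iff.2 hdet
  have h1 := finrank_ker_mulVecLin N
  have h2 : Module.finrank K (LinearMap.ker N.mulVecLin) ≤ 1 := by omega
  obtain ⟨i, hi⟩ := Function.ne_iff.1 hu0
  have hker : ∀ w, N *ᵥ w = 0 → w i = 0 → w = 0 := by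
    intro w hw hwi
    obtain ⟨g, hg⟩ := finrank_le_one_iff.1 h2
    obtain ⟨a, ha⟩ := hg ⟨u, by simpa using hu⟩
    obtain ⟨b, hb⟩ := hg ⟨w, by simpa using hw⟩
    have ha' : a • (g : Fin n → K) = u := congrArg Subtype.val ha
    have hb' : b • (g : Fin n → K) = w := congrArg Subtype.val hb
    have hgi : (g : Fin n → K) i ≠ 0 := by
      intro h; apply hi; simp [← ha', h]
    have hb0 : b = 0 := by
      rw [← hb'] at hwi
      simpa [hgi] using hwi
    rw [← hb', hb0, zero_smul]
  have hsurj : ∀ j, ∃ w, N *ᵥ w = Pi.single j 1 := by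
    intro j
    have hj : (N.updateRow j (Pi.single i 1)).det = 0 := by
      rw [← adjugate_apply, hadj]; rfl
    obtain ⟨w, hw0, hw⟩ := exists_mulVec_eq_zero_iff.2 hj
    have hwi : w i = 0 := by simpa [mulVec] using congrFun hw j
    have hwk : ∀ k ≠ j, (N *ᵥ w) k = 0 := fun k hk => by
      simpa [mulVec, hk] using congrFun hw k
    have hs : (N *ᵥ w) j ≠ 0 := by
      intro hs
      refine hw0 (hker w ?_ hwi)
      ext k
      by_cases hk : k = j
      · subst hk; simpa using hs
      · simpa using hwk k hk
    refine ⟨((N *ᵥ w) j)⁻¹ • w, ?_⟩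
    ext k
    rw [mulVec_smul]
    by_cases hk : k = j
    · subst hk; simp [hs]
    · simp [hk, hwk k hk]
  obtain ⟨y, hy0, hy⟩ := exists_vecMul_eq_zero_iff.2 hdet
  apply hy0
  ext j
  obtain ⟨w, hw⟩ := hsurj j
  have := congrArg (· ⬝ᵥ w) hy
  simpa [← dotProduct_mulVec, hw] using this

end adj

/-- The member of the net spanned by `A` with parameters `p`. -/
def netMember {K : Type*} [CommRing K] (A : Fin 3 → Matrix (Fin 4) (Fin 4) K) (p : Fin 3 → K) :
    Matrix (Fin 4) (Fin 4) K :=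
  ∑ k, p k • A k

/-- The tangent space at `u` of the base locus of the net spanned by `A` is reduced to the line
through `u`. -/
def IsTransversal {K : Type*} [CommRing K] (A : Fin 3 → Matrix (Fin 4) (Fin 4) K)
    (u : Fin 4 → K) : Prop :=
  ∀ z, (∀ k, u ⬝ᵥ A k *ᵥ z = 0) → ∃ c : K, z = c • u

section Hessian
variable {K : Type*} [Field K] {A : Fin 3 → Matrix (Fin 4) (Fin 4) K}

theorem netMember_isSymm (hA : ∀ k, (A k).IsSymm) (p : Fin 3 → K) : (netMember A p).IsSymm := by
  simp only [netMember, IsSymm, transpose_sum, transpose_smul, (hA _).eq]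

theorem netMember_mem_span (p : Fin 3 → K) :
    netMember A p ∈ Submodule.span K (Set.range A) :=
  (Submodule.mem_span_range_iff_exists_fun K).2 ⟨p, rfl⟩

theorem netMember_ne_zero (hA : LinearIndependent K A) {p : Fin 3 → K} (hp : p ≠ 0) :
    netMember A p ≠ 0 := fun h =>
  hp (funext (Fintype.linearIndependent_iff.1 hA p h))

theorem eval_hessian (p : Fin 3 → K) :
    eval p (Matrix.det (Matrix.of fun i j : Fin 4 =>
      X 0 * C (A 0 i j) + X 1 * C (A 1 i j) + X 2 * C (A 2 i j))) = (netMember A p).det := by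
  rw [RingHom.map_det]
  congr 1
  ext i j
  simp [netMember, Fin.sum_univ_three]

theorem eval_pderiv_hessian (p : Fin 3 → K) (k : Fin 3) :
    eval p (pderiv k (Matrix.det (Matrix.of fun i j : Fin 4 =>
      X 0 * C (A 0 i j) + X 1 * C (A 1 i j) + X 2 * C (A 2 i j)))) =
      ((netMember A p).adjugate * A k).trace := by
  rw [Derivation.apply_det, AddMonoidHom.map_trace, Matrix.map_mul]
  congr 2
  · change (eval p).mapMatrix _ = _
    rw [RingHom.map_adjugate]
    congr 1
    ext i j
    simp [netMember, Fin.sum_univ_three]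
  · ext i j
    fin_cases k <;> simp [pderiv_X]

theorem adjugate_eq_smul_vecMulVec {N : Matrix (Fin 4) (Fin 4) K} (hN : N.IsSymm)
    (hdet : N.det = 0) (hr : 3 ≤ N.rank) {u : Fin 4 → K} (hu0 : u ≠ 0) (hu : N *ᵥ u = 0) :
    ∃ c : K, c ≠ 0 ∧ N.adjugate = c • vecMulVec u u := by
  have hne : N.adjugate ≠ 0 := adjugate_ne_zero_of_rank (by omega)
  have hfin : Module.finrank K (LinearMap.ker N.mulVecLin) ≤ 1 := by
    have := finrank_ker_mulVecLin N
    omega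
  obtain ⟨i₀, hi₀⟩ := Function.ne_iff.1 hu0
  have hprop : ∀ w, N *ᵥ w = 0 → ∃ c : K, w = c • u := by
    intro w hw
    obtain ⟨g, hg⟩ := finrank_le_one_iff.1 hfin
    obtain ⟨a, ha⟩ := hg ⟨u, by simpa using hu⟩
    obtain ⟨b, hb⟩ := hg ⟨w, by simpa using hw⟩
    have ha' : a • (g : Fin 4 → K) = u := congrArg Subtype.val ha
    have hb' : b • (g : Fin 4 → K) = w := congrArg Subtype.val hb
    have ha0 : a ≠ 0 := by rintro rfl; exact hu0 (by simpa using ha'.symm)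
    exact ⟨b * a⁻¹, by rw [← ha', ← hb', smul_smul, mul_assoc, inv_mul_cancel₀ ha0, mul_one]⟩
  have hcol : ∀ j, ∃ c : K, (fun i => N.adjugate i j) = c • u := by
    intro j
    apply hprop
    ext i
    have := congrFun (congrFun (mul_adjugate N) i) j
    simpa [hdet, mul_apply, mulVec, dotProduct] using this
  choose r hr using hcol
  have hadj : ∀ i j, N.adjugate i j = r j * u i := fun i j => congrFun (hr j) i
  have hsym : ∀ i j, N.adjugate i j = N.adjugate j i := fun i j => (hN.adjugate.apply j i)
  have hr' : ∀ j, r j = r i₀ / u i₀ * u j := by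
    intro j
    have := hsym i₀ j
    rw [hadj, hadj] at this
    have hi : u i₀ ≠ 0 := hi₀
    field_simp
    exact this
  have hadj' : N.adjugate = (r i₀ / u i₀) • vecMulVec u u := by
    ext i j
    rw [hadj, hr' j]
    simp [vecMulVec_apply]
    ring
  refine ⟨r i₀ / u i₀, ?_, hadj'⟩
  intro h
  rw [h, zero_smul] at hadj'
  exact hne hadj'

theorem trace_vecMulVec_mul {n : Type*} [Fintype n] (u : n → K) (B : Matrix n n K) :
    (vecMulVec u u * B).trace = u ⬝ᵥ B *ᵥ u := by
  rw [vecMulVec_mul, trace_vecMulVec, dotProduct_mulVec, dotProduct_comm]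

theorem isTransversal_iff (hA : ∀ k, (A k).IsSymm) {u : Fin 4 → K} (hu0 : u ≠ 0)
    (hu : ∀ k, u ⬝ᵥ A k *ᵥ u = 0) :
    IsTransversal A u ↔ ∀ p ≠ 0, netMember A p *ᵥ u ≠ 0 := by
  set M : Matrix (Fin 3) (Fin 4) K := Matrix.of fun k => A k *ᵥ u with hM
  have hMz : ∀ z, M *ᵥ z = 0 ↔ ∀ k, u ⬝ᵥ A k *ᵥ z = 0 := by
    intro z
    rw [funext_iff]
    refine forall_congr' fun k => ?_
    rw [dotProduct_mulVec, ← mulVec_transpose, (hA k).eq]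
    rfl
  have hMp : ∀ p, p ᵥ* M = netMember A p *ᵥ u := by
    intro p
    ext i
    simp [netMember, vecMul, dotProduct, hM, sum_mulVec, smul_mulVec]
  have hfin := finrank_ker_mulVecLin M
  have huM : M *ᵥ u = 0 := (hMz u).2 hu
  have h1 : IsTransversal A u ↔ Module.finrank K (LinearMap.ker M.mulVecLin) = 1 := by
    constructor
    · intro h
      refine finrank_eq_one ⟨u, by simpa using huM⟩ (fun h => hu0 (congrArg Subtype.val h)) ?_
      rintro ⟨z, hz⟩
      obtain ⟨c, hc⟩ := h z ((hMz z).1 hz)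
      exact ⟨c, Subtype.ext hc.symm⟩
    · intro h z hz
      obtain ⟨c, hc⟩ := (finrank_eq_one_iff_of_nonzero' (⟨u, huM⟩ : LinearMap.ker M.mulVecLin)
        (fun h => hu0 (congrArg Subtype.val h))).1 h ⟨z, (hMz z).2 hz⟩
      exact ⟨c, (congrArg Subtype.val hc).symm⟩
  have h2 : (∀ p ≠ 0, netMember A p *ᵥ u ≠ 0) ↔ M.rank = 3 := by
    have hT := finrank_ker_mulVecLin Mᵀ
    rw [rank_transpose] at hT
    have : M.rank = 3 ↔ Module.finrank K (LinearMap.ker Mᵀ.mulVecLin) = 0 := by omega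
    rw [this, Submodule.finrank_eq_zero, Submodule.eq_bot_iff]
    simp only [LinearMap.mem_ker, mulVecLin_apply, mulVec_transpose, hMp]
    exact forall_congr' fun p => not_imp_not
  rw [h1, h2]
  omega

/-- The Hessian quartic of a net of quadrics in `ℙ³` is smooth if and only if all quadrics of the
net are irreducible and the base locus is transversal at each of its points. -/
theorem hessian_smooth_iff (hA : ∀ k, (A k).IsSymm) :
    (¬ ∃ p : Fin 3 → K, p ≠ 0 ∧ (netMember A p).det = 0 ∧
      ∀ k, ((netMember A p).adjugate * A k).trace = 0) ↔
    (∀ p ≠ 0, 3 ≤ (netMember A p).rank) ∧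
      ∀ u ≠ 0, (∀ k, u ⬝ᵥ A k *ᵥ u = 0) → IsTransversal A u := by
  constructor
  · intro h
    have hr : ∀ p ≠ 0, 3 ≤ (netMember A p).rank := by
      intro p hp
      by_contra hlt
      have hadj := adjugate_eq_zero_of_rank (N := netMember A p) (by omega)
      refine h ⟨p, hp, ?_, by simp [hadj]⟩
      have := congrFun (congrFun (mul_adjugate (netMember A p)) 0) 0
      simpa [hadj] using this.symm
    refine ⟨hr, fun u hu0 hu => (isTransversal_iff hA hu0 hu).2 fun p hp hpu => ?_⟩
    have hdet : (netMember A p).det = 0 := exists_mulVec_eq_zero_iff.1 ⟨u, hu0, hpu⟩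
    obtain ⟨c, -, hadj⟩ :=
      adjugate_eq_smul_vecMulVec (netMember_isSymm hA p) hdet (hr p hp) hu0 hpu
    refine h ⟨p, hp, hdet, fun k => ?_⟩
    rw [hadj, smul_mul, trace_smul, trace_vecMulVec_mul, hu k, smul_zero]
  · rintro ⟨hr, ht⟩ ⟨p, hp, hdet, hk⟩
    obtain ⟨u, hu0, hpu⟩ := exists_mulVec_eq_zero_iff.2 hdet
    obtain ⟨c, hc, hadj⟩ :=
      adjugate_eq_smul_vecMulVec (netMember_isSymm hA p) hdet (hr p hp) hu0 hpu
    have hu : ∀ k, u ⬝ᵥ A k *ᵥ u = 0 := by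
      intro k
      have := hk k
      rw [hadj, smul_mul, trace_smul, trace_vecMulVec_mul, smul_eq_mul] at this
      exact (mul_eq_zero.1 this).resolve_left hc
    exact (isTransversal_iff hA hu0 hu).1 (ht u hu0 hu) p hp hpu

end Hessian

section Configuration
variable {K : Type*} [Field K] {w : Fin 3 → Fin 4 → K}

/-- The combination with coefficients `t` of the Veronese images of the three points `w`. -/
def combo (w : Fin 3 → Fin 4 → K) (t : Fin 3 → K) (i j : Fin 4) : K :=
  ∑ m, t m * w m i * w m j

/-- `y` and `z` are conjugate with respect to all quadrics through the four coordinate points and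
the three points `w`. -/
def Conjugate (w : Fin 3 → Fin 4 → K) (y z : Fin 4 → K) : Prop :=
  ∃ t, ∀ i j, i ≠ j → y i * z j + y j * z i = combo w t i j

/-- The four coordinate points and the three points `w` are in general linear position. -/
structure GeneralPosition (w : Fin 3 → Fin 4 → K) : Prop where
  ne_zero : ∀ m i, w m i ≠ 0
  minor_ne_zero : ∀ m n, m ≠ n → ∀ i j, i ≠ j → w m i * w n j - w m j * w n i ≠ 0
  eq_zero_of_sum : ∀ i, ∀ t : Fin 3 → K, (∀ j, j ≠ i → ∑ m, t m * w m j = 0) → t = 0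

/-- The coefficient of `t m * t n` in the conic `X i j * X k l = X i k * X j l`,
where `X = combo w t`. -/
def conicCoeff (w : Fin 3 → Fin 4 → K) (i j k l : Fin 4) (m n : Fin 3) : K :=
  (w m i * w n l - w m l * w n i) * (w m j * w n k - w m k * w n j)

/-- The polar form of the conic `X i j * X k l = X i k * X j l`, where `X = combo w t`. -/
def conicPolar (w : Fin 3 → Fin 4 → K) (i j k l : Fin 4) (s t : Fin 3 → K) : K :=
  conicCoeff w i j k l 1 2 * (s 1 * t 2 + s 2 * t 1) +
  conicCoeff w i j k l 0 2 * (s 0 * t 2 + s 2 * t 0) +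
  conicCoeff w i j k l 0 1 * (s 0 * t 1 + s 1 * t 0)

/-- The cross product of the coefficient vectors of the two conics
`X 0 1 * X 2 3 = X 0 2 * X 1 3` and `X 0 1 * X 2 3 = X 0 3 * X 1 2`. -/
def conicCross (w : Fin 3 → Fin 4 → K) : Fin 3 → K :=
  crossProduct
    ![conicCoeff w 0 1 2 3 1 2, conicCoeff w 0 1 2 3 0 2, conicCoeff w 0 1 2 3 0 1]
    ![conicCoeff w 0 1 3 2 1 2, conicCoeff w 0 1 3 2 0 2, conicCoeff w 0 1 3 2 0 1]

theorem combo_comm (t : Fin 3 → K) (i j : Fin 4) : combo w t i j = combo w t j i :=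
  Finset.sum_congr rfl fun _ _ => by ring

theorem combo_smul (c : K) (t : Fin 3 → K) (i j : Fin 4) :
    combo w (c • t) i j = c * combo w t i j := by
  simp [combo, Finset.mul_sum, mul_assoc]

theorem combo_sub (s t : Fin 3 → K) (i j : Fin 4) :
    combo w (s - t) i j = combo w s i j - combo w t i j := by
  simp [combo, sub_mul, Finset.sum_sub_distrib]

theorem combo_single (m : Fin 3) (c : K) (i j : Fin 4) :
    combo w (Pi.single m c) i j = c * w m i * w m j := by
  simp [combo, Pi.single_apply]

theorem conicPolar_eq (i j k l : Fin 4) (s t : Fin 3 → K) :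
    conicPolar w i j k l s t =
      combo w s i j * combo w t k l + combo w t i j * combo w s k l -
      (combo w s i k * combo w t j l + combo w t i k * combo w s j l) := by
  simp only [conicPolar, conicCoeff, combo, Fin.sum_univ_three]
  ring

theorem conicPolar_mul_cross {s t : Fin 3 → K} (h₁ : conicPolar w 0 1 2 3 s t = 0)
    (h₂ : conicPolar w 0 1 3 2 s t = 0) :
    (s 1 * t 2 + s 2 * t 1) * conicCross w 1 = (s 0 * t 2 + s 2 * t 0) * conicCross w 0 ∧
    (s 0 * t 2 + s 2 * t 0) * conicCross w 2 = (s 0 * t 1 + s 1 * t 0) * conicCross w 1 ∧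
    (s 1 * t 2 + s 2 * t 1) * conicCross w 2 = (s 0 * t 1 + s 1 * t 0) * conicCross w 0 := by
  simp only [conicPolar] at h₁ h₂
  simp only [conicCross, cross_apply]
  simp
  refine ⟨?_, ?_, ?_⟩
  · linear_combination conicCoeff w 0 1 2 3 0 1 * h₂ - conicCoeff w 0 1 3 2 0 1 * h₁
  · linear_combination conicCoeff w 0 1 2 3 1 2 * h₂ - conicCoeff w 0 1 3 2 1 2 * h₁
  · linear_combination -conicCoeff w 0 1 2 3 0 2 * h₂ + conicCoeff w 0 1 3 2 0 2 * h₁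

/-- A vector whose products of distinct coordinates vanish is a multiple of a coordinate vector. -/
theorem exists_eq_single_of_mul_eq_zero {ι : Type*} [DecidableEq ι] [Nonempty ι] {y : ι → K}
    (h : ∀ i j, i ≠ j → y i * y j = 0) : ∃ i c, y = Pi.single i c := by
  by_cases hy : ∃ i, y i ≠ 0
  · obtain ⟨i, hi⟩ := hy
    refine ⟨i, y i, funext fun j => ?_⟩
    by_cases hj : j = i
    · subst hj; simp
    · simpa [hj] using (mul_eq_zero.1 (h i j (Ne.symm hj))).resolve_left hi
  · push Not at hy
    exact ⟨Classical.arbitrary ι, 0, by ext j; simp [hy j]⟩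

namespace GeneralPosition

theorem conicCoeff_ne_zero (hw : GeneralPosition w) {i j k l : Fin 4} (hil : i ≠ l) (hjk : j ≠ k)
    {m n : Fin 3} (hmn : m ≠ n) : conicCoeff w i j k l m n ≠ 0 :=
  mul_ne_zero (hw.minor_ne_zero m n hmn i l hil) (hw.minor_ne_zero m n hmn j k hjk)

theorem eq_zero_of_star (hw : GeneralPosition w) {t : Fin 3 → K} (i : Fin 4)
    (h : ∀ j, j ≠ i → combo w t i j = 0) : t = 0 := by
  have := hw.eq_zero_of_sum i (fun m => t m * w m i) h
  ext m
  exact (mul_eq_zero.1 (congrFun this m)).resolve_right (hw.ne_zero m i)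

theorem combo_injective (hw : GeneralPosition w) {s t : Fin 3 → K}
    (h : ∀ i j, i ≠ j → combo w s i j = combo w t i j) : s = t :=
  sub_eq_zero.1 <| hw.eq_zero_of_star 0 fun j hj => by
    rw [combo_sub, h 0 j hj.symm, sub_self]

/-- A common point of the two conics with a zero coordinate is a coordinate point. -/
theorem eq_single_of_conic [CharZero K] (hw : GeneralPosition w) {t : Fin 3 → K}
    (ht : conicPolar w 0 1 2 3 t t = 0) {m : Fin 3} (hm : t m = 0) :
    ∃ n c, t = Pi.single n c := by
  have h₀ : conicCoeff w 0 1 2 3 1 2 ≠ 0 :=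
    hw.conicCoeff_ne_zero (by decide) (by decide) (by decide)
  have h₁ : conicCoeff w 0 1 2 3 0 2 ≠ 0 :=
    hw.conicCoeff_ne_zero (by decide) (by decide) (by decide)
  have h₂ : conicCoeff w 0 1 2 3 0 1 ≠ 0 :=
    hw.conicCoeff_ne_zero (by decide) (by decide) (by decide)
  have hsum : conicCoeff w 0 1 2 3 1 2 * (t 1 * t 2) + conicCoeff w 0 1 2 3 0 2 * (t 0 * t 2) +
      conicCoeff w 0 1 2 3 0 1 * (t 0 * t 1) = 0 := by
    apply mul_left_cancel₀ (two_ne_zero (α := K))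
    rw [conicPolar] at ht
    linear_combination ht
  apply exists_eq_single_of_mul_eq_zero
  have key : t 0 * t 1 = 0 ∧ t 0 * t 2 = 0 ∧ t 1 * t 2 = 0 := by
    fin_cases m <;> simp_all
  intro i j hij
  fin_cases i <;> fin_cases j <;> first | exact absurd rfl hij | (simp_all <;> tauto)

end GeneralPosition

theorem exists_conjugate_of_polar [CharZero K] {x : Fin 4 → K} (hx : ∀ i, x i ≠ 0)
    {Y : Fin 4 → Fin 4 → K} (hY : ∀ i j, Y i j = Y j i)
    (h₁ : x 0 * x 1 * Y 2 3 + Y 0 1 * (x 2 * x 3) = x 0 * x 2 * Y 1 3 + Y 0 2 * (x 1 * x 3))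
    (h₂ : x 0 * x 1 * Y 2 3 + Y 0 1 * (x 2 * x 3) = x 0 * x 3 * Y 1 2 + Y 0 3 * (x 1 * x 2)) :
    ∃ z : Fin 4 → K, ∀ i j, i ≠ j → x i * z j + x j * z i = Y i j := by
  have h0 := hx 0
  have h1 := hx 1
  have h2 := hx 2
  have h3 := hx 3
  set s0 := (Y 0 1 / (x 0 * x 1) + Y 0 2 / (x 0 * x 2) - Y 1 2 / (x 1 * x 2)) / 2 with hs0
  set s1 := Y 0 1 / (x 0 * x 1) - s0 with hs1
  set s2 := Y 0 2 / (x 0 * x 2) - s0 with hs2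
  set s3 := Y 0 3 / (x 0 * x 3) - s0 with hs3
  have e01 : x 0 * (x 1 * s1) + x 1 * (x 0 * s0) = Y 0 1 := by
    rw [hs1]; field_simp; ring
  have e02 : x 0 * (x 2 * s2) + x 2 * (x 0 * s0) = Y 0 2 := by
    rw [hs2]; field_simp; ring
  have e03 : x 0 * (x 3 * s3) + x 3 * (x 0 * s0) = Y 0 3 := by
    rw [hs3]; field_simp; ring
  have e12 : x 1 * (x 2 * s2) + x 2 * (x 1 * s1) = Y 1 2 := by
    rw [hs2, hs1, hs0]; field_simp; ring
  have e13 : x 1 * (x 3 * s3) + x 3 * (x 1 * s1) = Y 1 3 := by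
    apply mul_left_cancel₀ (mul_ne_zero h0 h2)
    linear_combination h₁ - h₂ + x 0 * x 3 * e12 - x 1 * x 3 * e02 + x 1 * x 2 * e03
  have e23 : x 2 * (x 3 * s3) + x 3 * (x 2 * s2) = Y 2 3 := by
    apply mul_left_cancel₀ (mul_ne_zero h0 h1)
    linear_combination - h₂ + x 0 * x 3 * e12 + x 1 * x 2 * e03 - x 2 * x 3 * e01
  refine ⟨![x 0 * s0, x 1 * s1, x 2 * s2, x 3 * s3], fun i j hij => ?_⟩
  fin_cases i <;> fin_cases j <;> first | exact absurd rfl hij | skip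
  · simpa using e01
  · simpa using e02
  · simpa using e03
  · simpa [hY 1 0, add_comm] using e01
  · simpa using e12
  · simpa using e13
  · simpa [hY 2 0, add_comm] using e02
  · simpa [hY 2 1, add_comm] using e12
  · simpa using e23
  · simpa [hY 3 0, add_comm] using e03
  · simpa [hY 3 1, add_comm] using e13
  · simpa [hY 3 2, add_comm] using e23

/-- If two vectors with nonzero coordinates have proportional products of distinct coordinates, then
they are proportional. -/
theorem exists_smul_of_mul_eq {x y : Fin 4 → K} (hx : ∀ i, x i ≠ 0) (hy : ∀ i, y i ≠ 0) {k : K}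
    (h : ∀ i j, i ≠ j → y i * y j = k * (x i * x j)) : ∃ c : K, y = c • x := by
  have hk : ∀ i, i ≠ 0 → y i = k * x 0 / y 0 * x i := by
    intro i hi
    have h0 := hy 0
    have := h 0 i hi.symm
    field_simp
    linear_combination this
  have h12 := h 1 2 (by decide)
  rw [hk 1 (by decide), hk 2 (by decide)] at h12
  have hc : k * (x 0 * x 0) = y 0 * y 0 := by
    have h0 := hy 0
    have h1 := hx 1
    have h2 := hx 2
    have hk0 : k ≠ 0 := by
      rintro rfl
      exact mul_ne_zero (hy 0) (hy 1) (by simpa using h 0 1 (by decide))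
    field_simp at h12
    linear_combination h12
  refine ⟨k * x 0 / y 0, funext fun i => ?_⟩
  by_cases hi : i = 0
  · subst hi
    have h0 := hy 0
    simp only [Pi.smul_apply, smul_eq_mul]
    field_simp
    linear_combination -hc
  · simpa using hk i hi

end Configuration

section Configuration
variable {K : Type*} [Field K] {w : Fin 3 → Fin 4 → K}

/-- The base locus of the quadrics through the four coordinate points and the three points `w` has
trivial tangent space at `y`. -/
def ConjugateTrivial (w : Fin 3 → Fin 4 → K) (y : Fin 4 → K) : Prop :=
  ∀ z, Conjugate w y z → ∃ c : K, z = c • y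

theorem conjugate_self_iff [CharZero K] {y : Fin 4 → K} :
    Conjugate w y y ↔ ∃ t, ∀ i j, i ≠ j → y i * y j = combo w t i j := by
  constructor
  · rintro ⟨t, ht⟩
    refine ⟨(2⁻¹ : K) • t, fun i j hij => ?_⟩
    rw [combo_smul, ← ht i j hij]
    ring
  · rintro ⟨t, ht⟩
    refine ⟨(2 : K) • t, fun i j hij => ?_⟩
    rw [combo_smul, ← ht i j hij]
    ring

theorem conicPolar_eq_zero_of_mul_eq {y : Fin 4 → K} {t : Fin 3 → K}
    (h : ∀ i j, i ≠ j → y i * y j = combo w t i j) :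
    conicPolar w 0 1 2 3 t t = 0 ∧ conicPolar w 0 1 3 2 t t = 0 := by
  constructor <;> rw [conicPolar_eq] <;> repeat rw [← h _ _ (by decide)]
  all_goals ring

theorem conicPolar_eq_zero_of_conjugate {y z : Fin 4 → K} {s t : Fin 3 → K}
    (h : ∀ i j, i ≠ j → y i * y j = combo w s i j)
    (h' : ∀ i j, i ≠ j → y i * z j + y j * z i = combo w t i j) :
    conicPolar w 0 1 2 3 s t = 0 ∧ conicPolar w 0 1 3 2 s t = 0 := by
  constructor <;> rw [conicPolar_eq] <;> repeat rw [← h _ _ (by decide)]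
  all_goals repeat rw [← h' _ _ (by decide)]
  all_goals ring

theorem combo_products [CharZero K] {t : Fin 3 → K} (h₁ : conicPolar w 0 1 2 3 t t = 0)
    (h₂ : conicPolar w 0 1 3 2 t t = 0) :
    combo w t 0 1 * combo w t 2 3 = combo w t 0 2 * combo w t 1 3 ∧
      combo w t 0 1 * combo w t 2 3 = combo w t 0 3 * combo w t 1 2 := by
  rw [conicPolar_eq] at h₁ h₂
  have h2 := two_ne_zero (α := K)
  refine ⟨mul_left_cancel₀ h2 ?_, mul_left_cancel₀ h2 ?_⟩
  · linear_combination h₁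
  · rw [combo_comm t 3 2] at h₂
    linear_combination h₂

/-- A common point of the two conics comes from a base point, up to scaling, provided that it lies
in the domain of the inverse of the Veronese map. -/
theorem exists_lift [CharZero K] {t : Fin 3 → K} (h₁ : conicPolar w 0 1 2 3 t t = 0)
    (h₂ : conicPolar w 0 1 3 2 t t = 0) (h01 : combo w t 0 1 ≠ 0) (h02 : combo w t 0 2 ≠ 0)
    (h12 : combo w t 1 2 ≠ 0) :
    ∃ y : Fin 4 → K, y ≠ 0 ∧ ∃ k : K, k ≠ 0 ∧ ∀ i j, i ≠ j → y i * y j = combo w (k • t) i j := by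
  obtain ⟨e₁, e₂⟩ := combo_products h₁ h₂
  set a := combo w t 0 1 with ha
  set b := combo w t 0 2 with hb
  set c := combo w t 1 2 with hc
  set d := combo w t 0 3 with hd
  refine ⟨![a * b, a * c, b * c, d * c], fun h => mul_ne_zero h01 h02 (congrFun h 0),
    a * b * c, by simp [h01, h02, h12], fun i j hij => ?_⟩
  rw [combo_smul]
  fin_cases i <;> fin_cases j <;> first | exact absurd rfl hij | skip
  all_goals simp [combo_comm t 1 0, combo_comm t 2 0, combo_comm t 2 1, combo_comm t 3 0,
    combo_comm t 3 1, combo_comm t 3 2, ← ha, ← hb, ← hc, ← hd]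
  · ring
  · ring
  · ring
  · ring
  · ring
  · linear_combination -a * c * e₂ + a * c * e₁
  · ring
  · ring
  · linear_combination -b * c * e₂
  · ring
  · linear_combination -a * c * e₂ + a * c * e₁
  · linear_combination -b * c * e₂

theorem star_or_triangle [CharZero K] {t : Fin 3 → K} (h₁ : conicPolar w 0 1 2 3 t t = 0)
    (h₂ : conicPolar w 0 1 3 2 t t = 0) {i j : Fin 4} (hij : i ≠ j) (h : combo w t i j = 0) :
    (∃ i, ∀ j, j ≠ i → combo w t i j = 0) ∨
      ∃ i, ∀ j k, j ≠ i → k ≠ i → j ≠ k → combo w t j k = 0 := by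
  obtain ⟨e₁, e₂⟩ := combo_products h₁ h₂
  have h0 : combo w t 0 1 * combo w t 2 3 = 0 := by
    fin_cases i <;> fin_cases j <;> first | exact absurd rfl hij | skip
    all_goals
      simp [combo_comm t 1 0, combo_comm t 2 0, combo_comm t 2 1, combo_comm t 3 0,
        combo_comm t 3 1, combo_comm t 3 2] at h
      first
      | (simp [h]; done)
      | (rw [e₁]; simp [h]; done)
      | (rw [e₂]; simp [h])
  rw [h0] at e₁ e₂
  have c10 := combo_comm (w := w) t 1 0
  have c20 := combo_comm (w := w) t 2 0
  have c21 := combo_comm (w := w) t 2 1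
  have c30 := combo_comm (w := w) t 3 0
  have c31 := combo_comm (w := w) t 3 1
  have c32 := combo_comm (w := w) t 3 2
  rcases mul_eq_zero.1 h0 with a | a <;> rcases mul_eq_zero.1 e₁.symm with b | b <;>
    rcases mul_eq_zero.1 e₂.symm with c | c
  · exact .inl ⟨0, by simp [Fin.forall_fin_succ, a, b, c]⟩
  · exact .inr ⟨3, by simp [Fin.forall_fin_succ, a, b, c, c10, c20, c21, c30, c31, c32]⟩
  · exact .inr ⟨2, by simp [Fin.forall_fin_succ, a, b, c, c10, c20, c21, c30, c31]⟩
  · exact .inl ⟨1, by simp [Fin.forall_fin_succ, a, b, c, c10]⟩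
  · exact .inr ⟨1, by simp [Fin.forall_fin_succ, a, b, c, c10, c20, c30, c32]⟩
  · exact .inl ⟨2, by simp [Fin.forall_fin_succ, a, b, c, c20, c21]⟩
  · exact .inl ⟨3, by simp [Fin.forall_fin_succ, a, b, c, c30, c31, c32]⟩
  · exact .inr ⟨0, by simp [Fin.forall_fin_succ, a, b, c, c21, c31, c32]⟩

namespace GeneralPosition

theorem coord_ne_zero (hw : GeneralPosition w) {y : Fin 4 → K} {t : Fin 3 → K}
    (h : ∀ i j, i ≠ j → y i * y j = combo w t i j) (ht : t ≠ 0) (i : Fin 4) : y i ≠ 0 :=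
  fun hi => ht <| hw.eq_zero_of_star i fun j hj => by rw [← h i j hj.symm, hi, zero_mul]

/-- Base points with proportional images under the Veronese map are proportional. -/
theorem exists_smul_of_combo (hw : GeneralPosition w) {x y : Fin 4 → K} {s t : Fin 3 → K}
    (hx : ∀ i j, i ≠ j → x i * x j = combo w s i j) (hy : ∀ i j, i ≠ j → y i * y j = combo w t i j)
    (hs : s ≠ 0) (ht : t ≠ 0) {k : K} (hk : t = k • s) : ∃ c : K, y = c • x :=
  exists_smul_of_mul_eq (hw.coord_ne_zero hx hs) (hw.coord_ne_zero hy ht) (k := k)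
    fun i j hij => by rw [hy i j hij, hx i j hij, hk, combo_smul]

theorem exists_smul_of_single (hw : GeneralPosition w) {y : Fin 4 → K} {m : Fin 3} {c : K}
    (hy : ∀ i j, i ≠ j → y i * y j = combo w (Pi.single m c) i j) (hc : c ≠ 0) :
    ∃ c : K, y = c • w m :=
  hw.exists_smul_of_combo (x := w m) (s := Pi.single m 1) (k := c)
    (fun i j _ => by rw [combo_single, one_mul]) hy (by simp) (by simpa) (by simp [← Pi.single_smul'])

theorem eq_smul_of_conjugateTrivial [CharZero K] (hw : GeneralPosition w) {m : Fin 3}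
    (hm : ConjugateTrivial w (w m)) {t : Fin 3 → K}
    (h₁ : conicPolar w 0 1 2 3 (Pi.single m 1) t = 0)
    (h₂ : conicPolar w 0 1 3 2 (Pi.single m 1) t = 0) : ∃ c : K, t = Pi.single m c := by
  rw [conicPolar_eq] at h₁ h₂
  simp only [combo_single, one_mul] at h₁ h₂
  obtain ⟨z, hz⟩ := exists_conjugate_of_polar (hw.ne_zero m) (combo_comm (w := w) t)
    (by linear_combination h₁)
    (by rw [combo_comm t 3 2] at h₂; linear_combination h₂)
  obtain ⟨c, rfl⟩ := hm z ⟨t, hz⟩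
  refine ⟨2 * c, hw.combo_injective fun i j hij => ?_⟩
  rw [← hz i j hij, combo_single]
  simp only [Pi.smul_apply, smul_eq_mul]
  ring

theorem conicCross_ne_zero [CharZero K] (hw : GeneralPosition w) (h : ∀ m, ConjugateTrivial w (w m))
    (m : Fin 3) : conicCross w m ≠ 0 := by
  have hc : ∀ m n, m ≠ n → conicCoeff w 0 1 2 3 m n ≠ 0 := fun m n hmn =>
    hw.conicCoeff_ne_zero (by decide) (by decide) hmn
  intro hD
  simp only [conicCross, cross_apply] at hD
  fin_cases m
  · simp at hD
    obtain ⟨c, hc'⟩ := hw.eq_smul_of_conjugateTrivial (h 0)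
      (t := ![0, conicCoeff w 0 1 2 3 0 2, -conicCoeff w 0 1 2 3 0 1])
      (by simp [conicPolar]; ring) (by simp [conicPolar]; linear_combination hD)
    exact hc 0 2 (by decide) (by simpa using congrFun hc' 1)
  · simp at hD
    obtain ⟨c, hc'⟩ := hw.eq_smul_of_conjugateTrivial (h 1)
      (t := ![conicCoeff w 0 1 2 3 1 2, 0, -conicCoeff w 0 1 2 3 0 1])
      (by simp [conicPolar]; ring) (by simp [conicPolar]; linear_combination -hD)
    exact hc 1 2 (by decide) (by simpa using congrFun hc' 0)
  · simp at hD
    obtain ⟨c, hc'⟩ := hw.eq_smul_of_conjugateTrivial (h 2)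
      (t := ![conicCoeff w 0 1 2 3 1 2, -conicCoeff w 0 1 2 3 0 2, 0])
      (by simp [conicPolar]; ring) (by simp [conicPolar]; linear_combination hD)
    exact hc 1 2 (by decide) (by simpa using congrFun hc' 0)

theorem not_triangle (hw : GeneralPosition w) {i : Fin 4}
    (hi : ConjugateTrivial w (Pi.single i 1)) {t : Fin 3 → K} (ht : t ≠ 0) :
    ¬ ∀ j k, j ≠ i → k ≠ i → j ≠ k → combo w t j k = 0 := by
  intro h
  obtain ⟨c, hc⟩ := hi (Function.update (combo w t i) i 0) ⟨t, fun j k hjk => by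
    by_cases hj : j = i
    · subst hj
      simp [hjk.symm]
    · by_cases hk : k = i
      · subst hk
        simp [hj, combo_comm t j k]
      · simp [hj, hk, h j k hj hk hjk]⟩
  refine ht (hw.eq_zero_of_star i fun j hj => ?_)
  simpa [hj] using congrFun hc j

theorem _root_.mul_conicCross [CharZero K] {t : Fin 3 → K} (ht : ∀ m, t m ≠ 0)
    (h₁ : conicPolar w 0 1 2 3 t t = 0) (h₂ : conicPolar w 0 1 3 2 t t = 0) (m : Fin 3) :
    t m * conicCross w m = t 0 * conicCross w 0 := by
  obtain ⟨e₁, e₂, e₃⟩ := conicPolar_mul_cross h₁ h₂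
  have h2 := two_ne_zero (α := K)
  fin_cases m
  · rfl
  · apply mul_left_cancel₀ (mul_ne_zero h2 (ht 2))
    simp only [Fin.mk_one]
    linear_combination e₁
  · apply mul_left_cancel₀ (mul_ne_zero h2 (ht 1))
    simp only [Fin.reduceFinMk]
    linear_combination e₃

/-- Every base point is one of the seven given points or corresponds to a common point of the two
conics with nonzero coordinates. -/
theorem base_point_cases [CharZero K] (hw : GeneralPosition w) {y : Fin 4 → K}
    (hy : Conjugate w y y) :
    (∃ i c, y = Pi.single i c) ∨ (∃ m, ∃ c : K, c ≠ 0 ∧ ∀ i j, i ≠ j → y i * y j =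
      combo w (Pi.single m c) i j) ∨
      ∃ t : Fin 3 → K, (∀ m, t m ≠ 0) ∧ ∀ i j, i ≠ j → y i * y j = combo w t i j := by
  obtain ⟨t, ht⟩ := conjugate_self_iff.1 hy
  by_cases h : ∀ m, t m ≠ 0
  · exact .inr (.inr ⟨t, h, ht⟩)
  · push Not at h
    obtain ⟨m, hm⟩ := h
    obtain ⟨n, c, rfl⟩ := hw.eq_single_of_conic (conicPolar_eq_zero_of_mul_eq ht).1 hm
    by_cases hc : c = 0
    · left
      apply exists_eq_single_of_mul_eq_zero
      intro i j hij
      rw [ht i j hij, hc, combo_single, zero_mul, zero_mul]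
    · exact .inr (.inl ⟨n, c, hc, ht⟩)

/-- If the base locus has trivial tangent spaces at the seven given points, then there is exactly
one further base point. -/
theorem exists_eighth_point [CharZero K] (hw : GeneralPosition w)
    (hsingle : ∀ i, ConjugateTrivial w (Pi.single i 1)) (hpt : ∀ m, ConjugateTrivial w (w m)) :
    ∃ q : Fin 4 → K, q ≠ 0 ∧ Conjugate w q q ∧ (∀ i c, q ≠ Pi.single i c) ∧
      (∀ m, ∀ c : K, q ≠ c • w m) ∧
      ∀ y, Conjugate w y y → (∃ i c, y = Pi.single i c) ∨ (∃ m, ∃ c : K, y = c • w m) ∨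
        ∃ c : K, y = c • q := by
  have hD := hw.conicCross_ne_zero hpt
  set D := conicCross w with hDdef
  set t : Fin 3 → K := ![D 1 * D 2, D 0 * D 2, D 0 * D 1] with ht
  have ht0 : ∀ m, t m ≠ 0 := by
    intro m
    fin_cases m <;> simp [ht, hD]
  have htne : t ≠ 0 := fun h => ht0 0 (congrFun h 0)
  have h₁ : conicPolar w 0 1 2 3 t t = 0 := by
    simp [conicPolar, ht, hDdef, conicCross, cross_apply]
    ring
  have h₂ : conicPolar w 0 1 3 2 t t = 0 := by
    simp [conicPolar, ht, hDdef, conicCross, cross_apply]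
    ring
  have hX : ∀ i j, i ≠ j → combo w t i j ≠ 0 := by
    intro i j hij h
    rcases star_or_triangle h₁ h₂ hij h with ⟨i, hi⟩ | ⟨i, hi⟩
    · exact htne (hw.eq_zero_of_star i hi)
    · exact hw.not_triangle (hsingle i) htne hi
  obtain ⟨q, hq0, k, hk, hq⟩ := exists_lift h₁ h₂ (hX 0 1 (by decide)) (hX 0 2 (by decide))
    (hX 1 2 (by decide))
  have hqne := hw.coord_ne_zero hq (smul_ne_zero hk htne)
  refine ⟨q, hq0, conjugate_self_iff.2 ⟨_, hq⟩, ?_, ?_, fun y hy => ?_⟩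
  · rintro i c rfl
    obtain ⟨j, hj⟩ := exists_ne i
    exact hqne j (by simp [hj])
  · rintro m c rfl
    have : Pi.single m (c * c) = k • t := hw.combo_injective fun i j hij => by
      rw [← hq i j hij, combo_single]
      simp only [Pi.smul_apply, smul_eq_mul]
      ring
    obtain ⟨n, hn⟩ := exists_ne m
    have := congrFun this n
    simp [hn, hk, ht0] at this
  · rcases hw.base_point_cases hy with h | ⟨m, c, hc, h⟩ | ⟨s, hs0, hs⟩
    · exact .inl h
    · exact .inr (.inl ⟨m, hw.exists_smul_of_single h hc⟩)
    · refine .inr (.inr ?_)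
      have hsc := conicPolar_eq_zero_of_mul_eq hs
      have hm := mul_conicCross hs0 hsc.1 hsc.2
      refine hw.exists_smul_of_combo hq hs (smul_ne_zero hk htne) (fun h => hs0 0 (congrFun h 0))
        (k := s 0 / (k * t 0)) ?_
      have h0 : t 0 ≠ 0 := ht0 0
      ext m
      have hm' := hm m
      have htm : t m * D m = t 0 * D 0 := mul_conicCross ht0 h₁ h₂ m
      have hDm := hD m
      simp only [Pi.smul_apply, smul_eq_mul]
      field_simp
      apply mul_right_cancel₀ hDm
      linear_combination t 0 * hm' - s 0 * htm

end GeneralPosition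
end Configuration

section Configuration
variable {K : Type*} [Field K] [CharZero K] {w : Fin 3 → Fin 4 → K}

theorem finite_quadratic_roots {K : Type*} [Field K] {a b c : K} (ha : a ≠ 0) :
    {x : K | a * x ^ 2 + b * x + c = 0}.Finite := by
  by_cases h : ∃ x₀, a * x₀ ^ 2 + b * x₀ + c = 0
  · obtain ⟨x₀, h₀⟩ := h
    refine (Set.toFinite {x₀, -b / a - x₀}).subset fun x hx => ?_
    have hx' : a * x ^ 2 + b * x + c = 0 := hx
    have : (x - x₀) * (a * (x + x₀) + b) = 0 := by linear_combination hx' - h₀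
    rcases mul_eq_zero.1 this with h | h
    · exact .inl (sub_eq_zero.1 h)
    · right
      rw [Set.mem_singleton_iff]
      field_simp
      linear_combination h
  · push Not at h
    simp [h]

namespace GeneralPosition

/-- If the two conics coincide, then the base locus is infinite. -/
theorem exists_infinite_of_conicCross_eq_zero (hw : GeneralPosition w) (hD : conicCross w = 0) :
    ∃ (S : Set K) (f : K → Fin 4 → K), S.Infinite ∧
      (∀ τ ∈ S, f τ ≠ 0 ∧ Conjugate w (f τ) (f τ)) ∧
      ∀ τ ∈ S, ∀ τ' ∈ S, ∀ c : K, f τ' = c • f τ → τ = τ' := by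
  have hc : ∀ m n, m ≠ n → conicCoeff w 0 1 2 3 m n ≠ 0 := fun m n hmn =>
    hw.conicCoeff_ne_zero (by decide) (by decide) hmn
  set a₀ := conicCoeff w 0 1 2 3 1 2 with ha₀
  set a₁ := conicCoeff w 0 1 2 3 0 2 with ha₁
  set a₂ := conicCoeff w 0 1 2 3 0 1 with ha₂
  have ha₀' : a₀ ≠ 0 := hc 1 2 (by decide)
  have ha₁' : a₁ ≠ 0 := hc 0 2 (by decide)
  have ha₂' : a₂ ≠ 0 := hc 0 1 (by decide)
  have hD0 := congrFun hD 0
  have hD1 := congrFun hD 1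
  simp [conicCross, cross_apply, ← ha₀, ← ha₁, ← ha₂] at hD0 hD1
  set t : K → Fin 3 → K := fun τ => ![-a₂ * (a₀ * τ + a₁), -a₂ * τ * (a₀ * τ + a₁), a₂ ^ 2 * τ]
    with ht
  have h₁ : ∀ τ, conicPolar w 0 1 2 3 (t τ) (t τ) = 0 := by
    intro τ
    simp [conicPolar, ht]
    ring
  have h₂ : ∀ τ, conicPolar w 0 1 3 2 (t τ) (t τ) = 0 := by
    intro τ
    simp [conicPolar, ht]
    linear_combination (2 * a₂ ^ 2 * τ * (a₀ * τ + a₁)) * hD0 -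
      (2 * a₂ ^ 2 * τ ^ 2 * (a₀ * τ + a₁)) * hD1
  have hfin : ∀ i j, {τ | combo w (t τ) i j = 0}.Finite := by
    intro i j
    refine (finite_quadratic_roots (a := -a₂ * a₀ * w 1 i * w 1 j)
      (b := -a₂ * a₀ * w 0 i * w 0 j - a₂ * a₁ * w 1 i * w 1 j + a₂ ^ 2 * w 2 i * w 2 j)
      (c := -a₂ * a₁ * w 0 i * w 0 j) ?_).subset fun τ hτ => ?_
    · simp [ha₀', ha₂', hw.ne_zero]
    · rw [Set.mem_ofPred_eq] at hτ ⊢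
      rw [← hτ]
      simp [combo, Fin.sum_univ_three, ht]
      ring
  set S : Set K := ({τ | combo w (t τ) 0 1 = 0} ∪ {τ | combo w (t τ) 0 2 = 0} ∪
    {τ | combo w (t τ) 1 2 = 0} ∪ {τ | t τ 0 = 0})ᶜ with hS
  have hSinf : S.Infinite := by
    refine Set.Finite.infinite_compl
      ((((hfin 0 1).union (hfin 0 2)).union (hfin 1 2)).union ?_)
    refine (Set.finite_singleton (-a₁ / a₀)).subset fun τ hτ => ?_
    have : a₀ * τ + a₁ = 0 := by simpa [ht, ha₂'] using hτ
    rw [Set.mem_singleton_iff]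
    field_simp
    linear_combination this
  have hmem : ∀ τ ∈ S, combo w (t τ) 0 1 ≠ 0 ∧ combo w (t τ) 0 2 ≠ 0 ∧ combo w (t τ) 1 2 ≠ 0 ∧
      t τ 0 ≠ 0 := by
    intro τ hτ
    simpa [hS, and_assoc] using hτ
  have hex : ∀ τ, ∃ y : Fin 4 → K, τ ∈ S → y ≠ 0 ∧ ∃ k : K, k ≠ 0 ∧
      ∀ i j, i ≠ j → y i * y j = combo w (k • t τ) i j := by
    intro τ
    by_cases hτ : τ ∈ S
    · obtain ⟨h01, h02, h12, -⟩ := hmem τ hτ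
      obtain ⟨y, hy⟩ := exists_lift (h₁ τ) (h₂ τ) h01 h02 h12
      exact ⟨y, fun _ => hy⟩
    · exact ⟨0, fun h => absurd h hτ⟩
  choose f hf using hex
  refine ⟨S, f, hSinf, fun τ hτ => ?_, fun τ hτ τ' hτ' c h => ?_⟩
  · obtain ⟨h0, k, -, hk⟩ := hf τ hτ
    exact ⟨h0, conjugate_self_iff.2 ⟨_, hk⟩⟩
  · obtain ⟨-, k, hk0, hk⟩ := hf τ hτ
    obtain ⟨-, k', hk0', hk'⟩ := hf τ' hτ'
    have hprop : k' • t τ' = (c * c * k) • t τ := hw.combo_injective fun i j hij => by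
      rw [← hk' i j hij, mul_smul, combo_smul, ← hk i j hij, h]
      simp only [Pi.smul_apply, smul_eq_mul]
      ring
    have e0 := congrFun hprop 0
    have e1 := congrFun hprop 1
    have ht0' := (hmem τ' hτ').2.2.2
    have ht1 : ∀ τ, t τ 1 = τ * t τ 0 := fun τ => by simp [ht]; ring
    simp only [Pi.smul_apply, smul_eq_mul, ht1] at e0 e1
    have : k' * t τ' 0 * (τ - τ') = 0 := by linear_combination τ * e0 - e1
    exact sub_eq_zero.1 ((mul_eq_zero.1 this).resolve_left (mul_ne_zero hk0' ht0'))

theorem conjugateTrivial_of_smul (hw : GeneralPosition w) {y : Fin 4 → K} {s : Fin 3 → K}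
    (hs : s ≠ 0) (hy : ∀ i j, i ≠ j → y i * y j = combo w s i j)
    (h : ∀ t, conicPolar w 0 1 2 3 s t = 0 → conicPolar w 0 1 3 2 s t = 0 → ∃ k : K, t = k • s) :
    ConjugateTrivial w y := by
  rintro z ⟨t, hz⟩
  have hp := conicPolar_eq_zero_of_conjugate hy hz
  obtain ⟨k, rfl⟩ := h t hp.1 hp.2
  have hne := hw.coord_ne_zero hy hs
  have hr : ∀ i j, i ≠ j → z i / y i + z j / y j = k := by
    intro i j hij
    have h := hz i j hij
    rw [combo_smul, ← hy i j hij] at h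
    have hi := hne i
    have hj := hne j
    field_simp
    linear_combination h
  have h01 := hr 0 1 (by decide)
  have h02 := hr 0 2 (by decide)
  have h12 := hr 1 2 (by decide)
  have h0 : z 0 / y 0 = k / 2 := by linear_combination (h01 + h02 - h12) / 2
  refine ⟨k / 2, funext fun i => ?_⟩
  rw [Pi.smul_apply, smul_eq_mul, ← div_eq_iff (hne i)]
  by_cases hi : i = 0
  · rw [hi, h0]
  · linear_combination hr 0 i (Ne.symm hi) - h0

/-- If there is an eighth base point and the two conics are distinct, then the base locus has
trivial tangent spaces. -/
theorem conjugateTrivial_of_eighth_point (hw : GeneralPosition w) (hD : conicCross w ≠ 0)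
    {q : Fin 4 → K} (hq : Conjugate w q q) (hsingle : ∀ i c, q ≠ Pi.single i c)
    (hpt : ∀ m, ∀ c : K, q ≠ c • w m) {y : Fin 4 → K} (hy0 : y ≠ 0) (hy : Conjugate w y y) :
    ConjugateTrivial w y := by
  obtain ⟨t, ht0, ht⟩ : ∃ t : Fin 3 → K, (∀ m, t m ≠ 0) ∧
      ∀ i j, i ≠ j → q i * q j = combo w t i j := by
    rcases hw.base_point_cases hq with ⟨i, c, h⟩ | ⟨m, c, hc, h⟩ | h
    · exact absurd h (hsingle i c)
    · obtain ⟨c, h⟩ := hw.exists_smul_of_single h hc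
      exact absurd h (hpt m c)
    · exact h
  have htc := conicPolar_eq_zero_of_mul_eq ht
  have hqne := hw.coord_ne_zero ht fun h => ht0 0 (congrFun h 0)
  have htD := mul_conicCross ht0 htc.1 htc.2
  have hD0 : conicCross w 0 ≠ 0 := by
    intro h
    apply hD
    ext m
    simpa [h, ht0] using htD m
  have hDm : ∀ m, conicCross w m ≠ 0 := by
    intro m h
    have := htD m
    simp [h, ht0, hD0] at this
  rcases hw.base_point_cases hy with ⟨i, c, rfl⟩ | ⟨m, c, hc, h⟩ | ⟨s, hs0, hs⟩
  · have hc : c ≠ 0 := by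
      rintro rfl
      exact hy0 (Pi.single_zero i)
    rintro z ⟨s, hz⟩
    have hX : ∀ j k, j ≠ i → k ≠ i → j ≠ k → combo w s j k = 0 := by
      intro j k hj hk hjk
      rw [← hz j k hjk]
      simp [hj, hk]
    have hconic : conicPolar w 0 1 2 3 s s = 0 ∧ conicPolar w 0 1 3 2 s s = 0 := by
      simp only [conicPolar_eq]
      fin_cases i
      · simp [hX 1 2, hX 1 3, hX 2 3, hX 3 2]
      · simp [hX 0 2, hX 0 3, hX 2 3, hX 3 2]
      · simp [hX 0 1, hX 0 3, hX 1 3]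
      · simp [hX 0 1, hX 0 2, hX 1 2]
    obtain ⟨j, k, hj, hk, hjk⟩ : ∃ j k : Fin 4, j ≠ i ∧ k ≠ i ∧ j ≠ k :=
      (show ∀ i : Fin 4, ∃ j k : Fin 4, j ≠ i ∧ k ≠ i ∧ j ≠ k by decide) i
    have hs : s = 0 := by
      by_cases h : ∀ m, s m ≠ 0
      · exfalso
        have hsD := mul_conicCross h hconic.1 hconic.2
        have hsm : s = (s 0 / t 0) • t := by
          ext m
          have h1 := htD m
          have h2 := hsD m
          have h0 := ht0 0
          simp only [Pi.smul_apply, smul_eq_mul]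
          field_simp
          apply mul_right_cancel₀ (hDm m)
          linear_combination t 0 * h2 - s 0 * h1
        have := hX j k hj hk hjk
        rw [hsm, combo_smul, ← ht j k hjk] at this
        simp [h, ht0, hqne] at this
      · push Not at h
        obtain ⟨m, hm⟩ := h
        obtain ⟨n, d, rfl⟩ := hw.eq_single_of_conic hconic.1 hm
        have := hX j k hj hk hjk
        simp [combo_single, hw.ne_zero] at this
        rw [this, Pi.single_zero]
    refine ⟨z i / c, funext fun l => ?_⟩
    by_cases hl : l = i
    · subst hl; simp [hc]
    · have := hz i l (Ne.symm hl)
      simpa [hs, hl, combo, hc] using this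
  · refine hw.conjugateTrivial_of_smul (by simpa using hc) h fun t h₁ h₂ => ?_
    obtain ⟨e₁, e₂, e₃⟩ := conicPolar_mul_cross h₁ h₂
    refine ⟨t m / c, ?_⟩
    ext n
    have d0 := hDm 0
    have d1 := hDm 1
    have d2 := hDm 2
    fin_cases m <;> fin_cases n <;> simp_all
  · refine hw.conjugateTrivial_of_smul (fun h => hs0 0 (congrFun h 0)) hs fun t h₁ h₂ => ?_
    obtain ⟨e₁, e₂, e₃⟩ := conicPolar_mul_cross h₁ h₂
    have hsc := conicPolar_eq_zero_of_mul_eq hs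
    have f1 := mul_conicCross hs0 hsc.1 hsc.2 1
    have f2 := mul_conicCross hs0 hsc.1 hsc.2 2
    have s0 := hs0 0
    have s1 := hs0 1
    have s2 := hs0 2
    have g1 : t 1 * s 0 = t 0 * s 1 := by
      apply mul_right_cancel₀ (mul_ne_zero s2 hD0)
      linear_combination s 1 * e₁ - (s 1 * t 2 + s 2 * t 1) * f1
    have g2 : t 2 * s 0 = t 0 * s 2 := by
      apply mul_right_cancel₀ (mul_ne_zero s1 hD0)
      linear_combination s 2 * e₃ - (s 1 * t 2 + s 2 * t 1) * f2
    refine ⟨t 0 / s 0, funext fun m => ?_⟩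
    simp only [Pi.smul_apply, smul_eq_mul]
    fin_cases m <;> simp <;> field_simp
    · exact g1
    · exact g2

end GeneralPosition
end Configuration

section Heptad
variable {K : Type*} [Field K]

/-- `y` and `z` are conjugate with respect to all quadrics through the seven points `v`. -/
def NetConjugate (v : Fin 7 → Fin 4 → K) (y z : Fin 4 → K) : Prop :=
  ∀ B : Matrix (Fin 4) (Fin 4) K, B.IsSymm → (∀ i, v i ⬝ᵥ B *ᵥ v i = 0) → y ⬝ᵥ B *ᵥ z = 0

/-- All quadrics through the seven points `v` are irreducible. -/
def QuadricsIrreducible (v : Fin 7 → Fin 4 → K) : Prop :=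
  ∀ B : Matrix (Fin 4) (Fin 4) K, B.IsSymm → (∀ i, v i ⬝ᵥ B *ᵥ v i = 0) → B ≠ 0 → 3 ≤ B.rank

/-- No four of the seven points `v` are coplanar. -/
def NoFourCoplanar (v : Fin 7 → Fin 4 → K) : Prop :=
  ∀ f : Fin 4 → Fin 7, Function.Injective f → ∀ l : Fin 4 → K, (∀ k, v (f k) ⬝ᵥ l = 0) → l = 0

theorem rank_vecMulVec_add_le (l n : Fin 4 → K) : (vecMulVec l n + vecMulVec n l).rank ≤ 2 := by
  have h : vecMulVec l n + vecMulVec n l =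
      (Matrix.of ![l, n])ᵀ * (Matrix.of ![n, l] : Matrix (Fin 2) (Fin 4) K) := by
    ext i j
    simp [Matrix.mul_apply, vecMulVec_apply, Fin.sum_univ_two]
  rw [h]
  exact (rank_mul_le_left _ _).trans (rank_le_width _)

theorem vecMulVec_add_ne_zero [CharZero K] {l n : Fin 4 → K} (hl : l ≠ 0) (hn : n ≠ 0) :
    vecMulVec l n + vecMulVec n l ≠ 0 := by
  intro h
  obtain ⟨i, hi⟩ := Function.ne_iff.1 hl
  obtain ⟨j, hj⟩ := Function.ne_iff.1 hn
  simp only [Pi.zero_apply] at hi hj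
  have hii := congrFun (congrFun h i) i
  have hij := congrFun (congrFun h i) j
  simp only [Matrix.add_apply, vecMulVec_apply, Matrix.zero_apply] at hii hij
  have hni : n i = 0 := by
    have : (2 * l i) * n i = 0 := by linear_combination hii
    simpa [hi] using this
  simp [hni, hi, hj] at hij

theorem QuadricsIrreducible.noFourCoplanar [CharZero K] {v : Fin 7 → Fin 4 → K}
    (hv : QuadricsIrreducible v) : NoFourCoplanar v := by
  intro f hf l hl
  by_contra hl0
  let M : Matrix {i // i ∉ Set.range f} (Fin 4) K := Matrix.of fun i => v i
  have hcard : Fintype.card {i // i ∉ Set.range f} = 3 := by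
    rw [Fintype.card_subtype_compl, Set.card_range_of_injective hf]
    rfl
  obtain ⟨n, hn, hn0⟩ := Submodule.exists_mem_ne_zero_of_ne_bot
    (LinearMap.ker_ne_bot_of_finrank_lt (f := M.mulVecLin) (by
      rw [Module.finrank_fintype_fun_eq_card, Module.finrank_fintype_fun_eq_card, hcard]
      simp))
  have hn' : ∀ i, i ∉ Set.range f → v i ⬝ᵥ n = 0 := fun i hi => congrFun hn ⟨i, hi⟩
  have h := hv (vecMulVec l n + vecMulVec n l) ?_ ?_ (vecMulVec_add_ne_zero hl0 hn0)
  · have := rank_vecMulVec_add_le l n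
    omega
  · ext i j
    simp [vecMulVec_apply]
    ring
  · intro i
    rw [add_mulVec, dotProduct_add, vecMulVec_mulVec, vecMulVec_mulVec]
    by_cases hi : i ∈ Set.range f
    · obtain ⟨k, rfl⟩ := hi
      simp [hl k, dotProduct_comm l]
    · simp [hn' i hi, dotProduct_comm n]

theorem NoFourCoplanar.det_ne_zero {v : Fin 7 → Fin 4 → K} (hv : NoFourCoplanar v)
    {f : Fin 4 → Fin 7} (hf : Function.Injective f) :
    (Matrix.of fun k => v (f k)).det ≠ 0 := by
  intro h
  obtain ⟨l, hl0, hl⟩ := exists_mulVec_eq_zero_iff.2 h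
  exact hl0 (hv f hf l fun k => congrFun hl k)

theorem NoFourCoplanar.generalPosition {x : Fin 7 → Fin 4 → K} (hx : NoFourCoplanar x)
    {w : Fin 3 → Fin 4 → K} (he : ∀ j : Fin 4, x (Fin.castAdd 3 j) = Pi.single j 1)
    (hw : ∀ m : Fin 3, x (Fin.natAdd 4 m) = w m) : GeneralPosition w := by
  have hne : ∀ m i, w m i ≠ 0 := by
    intro m i h
    have hf : ∀ (i : Fin 4) (m : Fin 3), Function.Injective fun k : Fin 4 =>
      if k = i then (Fin.natAdd 4 m : Fin 7) else Fin.castAdd 3 k := by decide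
    have := hx _ (hf i m) (Pi.single i 1) fun k => by
      by_cases hk : k = i
      · simp [hk, hw, h]
      · simp [hk, he, Ne.symm hk]
    simpa using congrFun this i
  refine ⟨hne, ?_, ?_⟩
  · intro m n hmn i j hij h
    have hf : ∀ (i j : Fin 4) (m n : Fin 3), i ≠ j → m ≠ n → Function.Injective fun k : Fin 4 =>
      if k = i then (Fin.natAdd 4 m : Fin 7) else if k = j then Fin.natAdd 4 n
      else Fin.castAdd 3 k := by decide
    have := hx _ (hf i j m n hij hmn) (w m j • Pi.single i 1 - w m i • Pi.single j 1) fun k => by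
      by_cases hk : k = i
      · simp [hk, hw, dotProduct_sub]
        ring
      · by_cases hk' : k = j
        · simp [hk', Ne.symm hij, hw, dotProduct_sub]
          linear_combination -h
        · simp [hk, hk', he, dotProduct_sub, Ne.symm hk, Ne.symm hk']
    have := congrFun this i
    simp [hij, hne] at this
  · intro i t ht
    have hf : ∀ i : Fin 4, Function.Injective
      (Fin.cons (Fin.castAdd 3 i) (Fin.natAdd 4) : Fin 4 → Fin 7) := by decide
    have hdet := hx.det_ne_zero (hf i)
    by_contra ht0
    refine hdet (exists_vecMul_eq_zero_iff.1
      ⟨Fin.cons (-∑ m, t m * w m i) t, fun h => ht0 ?_, ?_⟩)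
    · ext m
      exact congrFun h m.succ
    · ext j
      rw [vecMul, dotProduct, Fin.sum_univ_succ]
      by_cases hj : j = i
      · subst hj
        simp [he, hw]
      · simp [he, hw, hj, ht j hj]

theorem netConjugate_mulVec_iff {x : Fin 7 → Fin 4 → K} {P : Matrix (Fin 4) (Fin 4) K}
    (hP : IsUnit P.det) {y z : Fin 4 → K} :
    NetConjugate (fun i => P *ᵥ x i) (P *ᵥ y) (P *ᵥ z) ↔ NetConjugate x y z := by
  have key : ∀ (B : Matrix (Fin 4) (Fin 4) K) (y z : Fin 4 → K),
      (P *ᵥ y) ⬝ᵥ B *ᵥ (P *ᵥ z) = y ⬝ᵥ (Pᵀ * B * P) *ᵥ z := by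
    intro B y z
    rw [← mulVec_mulVec, ← mulVec_mulVec, dotProduct_mulVec y, vecMul_transpose]
  have hsymm : ∀ (Q B : Matrix (Fin 4) (Fin 4) K), B.IsSymm → (Qᵀ * B * Q).IsSymm := by
    intro Q B hB
    simp [IsSymm, transpose_mul, hB.eq, Matrix.mul_assoc]
  constructor
  · intro h B hB hx
    have hB' : Pᵀ * ((P⁻¹)ᵀ * B * P⁻¹) * P = B := by
      have h1 : Pᵀ * (P⁻¹)ᵀ = 1 := by rw [← transpose_mul, nonsing_inv_mul _ hP, transpose_one]
      rw [Matrix.mul_assoc, Matrix.mul_assoc, nonsing_inv_mul _ hP, Matrix.mul_one,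
        ← Matrix.mul_assoc, h1, Matrix.one_mul]
    have := h _ (hsymm P⁻¹ B hB) fun i => by rw [key, hB', hx i]
    rwa [key, hB'] at this
  · intro h B hB hx
    rw [key]
    exact h _ (hsymm P B hB) fun i => by rw [← key, hx i]

/-- The symmetric matrix with zero diagonal whose off-diagonal entries are those of `g + gᵀ`. -/
def offDiagSymm (g : Matrix (Fin 4) (Fin 4) K) : Matrix (Fin 4) (Fin 4) K :=
  Matrix.of fun i j => if i = j then 0 else g i j + g j i

/-- The value at `y, z` of the bilinear form of `offDiagSymm g`, as a linear functional in `g`. -/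
def offDiagFunctional (y z : Fin 4 → K) : Matrix (Fin 4) (Fin 4) K →ₗ[K] K where
  toFun g := y ⬝ᵥ offDiagSymm g *ᵥ z
  map_add' g h := by
    rw [← dotProduct_add, ← add_mulVec]
    congr 2
    ext i j
    by_cases hij : i = j <;> simp [offDiagSymm, hij]
    ring
  map_smul' c g := by
    rw [RingHom.id_apply, ← dotProduct_smul, ← smul_mulVec]
    congr 2
    ext i j
    by_cases hij : i = j <;> simp [offDiagSymm, hij, mul_add]

theorem offDiagFunctional_single (y z : Fin 4 → K) {i j : Fin 4} (hij : i ≠ j) :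
    offDiagFunctional y z (Matrix.single i j 1) = y i * z j + y j * z i := by
  have h : offDiagSymm (Matrix.single i j (1 : K)) =
      Matrix.single i j 1 + Matrix.single j i 1 := by
    ext a b
    by_cases hab : a = b
    · subst hab
      simp [offDiagSymm, Matrix.single_apply]
      grind
    · simp [offDiagSymm, Matrix.single_apply, hab]
      grind
  change y ⬝ᵥ offDiagSymm _ *ᵥ z = _
  rw [h, add_mulVec, dotProduct_add]
  simp [single_mulVec_eq, mul_comm]

theorem netConjugate_iff [CharZero K] {x : Fin 7 → Fin 4 → K} {w : Fin 3 → Fin 4 → K}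
    (he : ∀ j : Fin 4, x (Fin.castAdd 3 j) = Pi.single j 1)
    (hw : ∀ m : Fin 3, x (Fin.natAdd 4 m) = w m) {y z : Fin 4 → K} :
    NetConjugate x y z ↔ Conjugate w y z := by
  constructor
  · intro h
    have hmem : offDiagFunctional y z ∈
        Submodule.span K (Set.range fun m => offDiagFunctional (w m) (w m)) := by
      refine mem_span_of_iInf_ker_le_ker fun g hg => ?_
      simp only [Submodule.mem_iInf, LinearMap.mem_ker] at hg ⊢
      refine h (offDiagSymm g) ?_ fun i => ?_
      · ext i j
        simp [offDiagSymm, eq_comm, add_comm]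
      · refine Fin.addCases (m := 4) (n := 3) (fun j => ?_) (fun m => ?_) i
        · rw [he]
          simp [offDiagSymm]
        · rw [hw]
          exact hg m
    obtain ⟨t, ht⟩ := (Submodule.mem_span_range_iff_exists_fun K).1 hmem
    refine ⟨fun m => 2 * t m, fun i j hij => ?_⟩
    rw [← offDiagFunctional_single y z hij, ← ht]
    simp only [LinearMap.sum_apply, LinearMap.smul_apply, smul_eq_mul,
      offDiagFunctional_single _ _ hij, combo]
    exact Finset.sum_congr rfl fun m _ => by ring
  · rintro ⟨t, ht⟩ B hB hx
    have hd : ∀ j, B j j = 0 := fun j => by simpa [he] using hx (Fin.castAdd 3 j)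
    have hq : ∀ m, w m ⬝ᵥ B *ᵥ w m = 0 := fun m => by simpa [hw] using hx (Fin.natAdd 4 m)
    have hs : ∀ (i j : Fin 4), B i j = B j i := fun i j => hB.apply j i
    have q0 := hq 0
    have q1 := hq 1
    have q2 := hq 2
    simp only [dotProduct, mulVec, Fin.sum_univ_four, hd, hs 1 0, hs 2 0, hs 2 1, hs 3 0, hs 3 1,
      hs 3 2] at q0 q1 q2 ⊢
    have h01 := ht 0 1 (by decide)
    have h02 := ht 0 2 (by decide)
    have h03 := ht 0 3 (by decide)
    have h12 := ht 1 2 (by decide)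
    have h13 := ht 1 3 (by decide)
    have h23 := ht 2 3 (by decide)
    simp only [combo, Fin.sum_univ_three] at h01 h02 h03 h12 h13 h23
    linear_combination B 0 1 * h01 + B 0 2 * h02 + B 0 3 * h03 + B 1 2 * h12 + B 1 3 * h13 +
      B 2 3 * h23 + (t 0 * q0 + t 1 * q1 + t 2 * q2) / 2

/-- In suitable coordinates, four of the seven points become the coordinate points, and the other
three are in general position. -/
theorem QuadricsIrreducible.exists_coordinates [CharZero K] {v : Fin 7 → Fin 4 → K}
    (hv : QuadricsIrreducible v) :
    ∃ (P : Matrix (Fin 4) (Fin 4) K) (w : Fin 3 → Fin 4 → K), IsUnit P.det ∧ GeneralPosition w ∧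
      (∀ j : Fin 4, v (Fin.castAdd 3 j) = P *ᵥ Pi.single j 1) ∧
      (∀ m : Fin 3, v (Fin.natAdd 4 m) = P *ᵥ w m) ∧
      ∀ y z, NetConjugate v (P *ᵥ y) (P *ᵥ z) ↔ Conjugate w y z := by
  have hgp := hv.noFourCoplanar
  let P : Matrix (Fin 4) (Fin 4) K := (Matrix.of fun k => v (Fin.castAdd 3 k))ᵀ
  have hP : IsUnit P.det := by
    rw [det_transpose, isUnit_iff_ne_zero]
    exact hgp.det_ne_zero (Fin.castAdd_injective 4 3)
  let x : Fin 7 → Fin 4 → K := fun i => P⁻¹ *ᵥ v i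
  have hvx : v = fun i => P *ᵥ x i := by
    ext1 i
    simp [x, mulVec_mulVec, mul_nonsing_inv _ hP]
  have hPe : ∀ j : Fin 4, v (Fin.castAdd 3 j) = P *ᵥ Pi.single j 1 := fun j => by
    ext i
    simp [P]
  have he : ∀ j : Fin 4, x (Fin.castAdd 3 j) = Pi.single j 1 := fun j => by
    simp only [x]
    rw [hPe, mulVec_mulVec, nonsing_inv_mul _ hP, one_mulVec]
  have hx : NoFourCoplanar x := by
    intro f hf l hl
    have := hgp f hf (l ᵥ* P⁻¹) fun k => by
      rw [dotProduct_comm, ← dotProduct_mulVec, dotProduct_comm]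
      exact hl k
    have h := congrArg (· ᵥ* P) this
    simpa [vecMul_vecMul, nonsing_inv_mul _ hP] using h
  refine ⟨P, fun m => x (Fin.natAdd 4 m), hP, hx.generalPosition he fun _ => rfl, hPe,
    fun m => congrFun hvx _, fun y z => ?_⟩
  rw [hvx, netConjugate_mulVec_iff hP]
  exact netConjugate_iff he fun _ => rfl

theorem netConjugate_smul_iff {v : Fin 7 → Fin 4 → K} {c : K} (hc : c ≠ 0) {y : Fin 4 → K} :
    NetConjugate v (c • y) (c • y) ↔ NetConjugate v y y := by
  simp [NetConjugate, mulVec_smul, hc]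

theorem netConjugate_rep_mk {v : Fin 7 → Fin 4 → K} {u : Fin 4 → K} (hu : u ≠ 0) :
    NetConjugate v (Projectivization.mk K u hu).rep (Projectivization.mk K u hu).rep ↔
      NetConjugate v u u := by
  obtain ⟨a, ha⟩ := Projectivization.exists_smul_eq_mk_rep K u hu
  rw [← ha]
  exact netConjugate_smul_iff a.ne_zero

open Projectivization in
theorem QuadricsIrreducible.transversal_iff [CharZero K] {v : Fin 7 → Fin 4 → K}
    (hv : QuadricsIrreducible v) (hv0 : ∀ i, v i ≠ 0)
    (hvp : ∀ i j, i ≠ j → ∀ c : K, v j ≠ c • v i) :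
    (∀ u ≠ 0, NetConjugate v u u → ∀ z, NetConjugate v u z → ∃ c : K, z = c • u) ↔
      ∃ p : Fin 8 → Projectivization K (Fin 4 → K), Function.Injective p ∧
        {x : Projectivization K (Fin 4 → K) | NetConjugate v x.rep x.rep} = Set.range p := by
  obtain ⟨P, w, hP, hw, he, hvw, hconj⟩ := hv.exists_coordinates
  have hinj : Function.Injective P.mulVec := mulVec_injective_of_isUnit
    ((isUnit_iff_isUnit_det P).2 hP)
  have hP0 : ∀ {y}, y ≠ 0 → P *ᵥ y ≠ 0 := fun hy h => hy (hinj (by rw [h, mulVec_zero]))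
  have hsurj : ∀ u, ∃ y, u = P *ᵥ y := fun u =>
    ⟨P⁻¹ *ᵥ u, by rw [mulVec_mulVec, mul_nonsing_inv _ hP, one_mulVec]⟩
  have hsingle : ∀ i (c : K), P *ᵥ Pi.single i c = c • v (Fin.castAdd 3 i) := fun i c => by
    rw [he, ← mulVec_smul, ← Pi.single_smul]
    simp
  have hself : ∀ i, NetConjugate v (v i) (v i) := fun i B _ h => h i
  let s : Fin 7 → Projectivization K (Fin 4 → K) := fun i => mk K (v i) (hv0 i)
  have hs : Function.Injective s := by
    intro i j hij
    by_contra hne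
    obtain ⟨a, ha⟩ := (mk_eq_mk_iff' K _ _ (hv0 i) (hv0 j)).1 hij
    exact hvp j i (Ne.symm hne) a ha.symm
  constructor
  · intro h
    have htriv : ∀ y ≠ 0, Conjugate w y y → ConjugateTrivial w y := by
      intro y hy hyy z hz
      obtain ⟨c, hc⟩ := h (P *ᵥ y) (hP0 hy) ((hconj y y).2 hyy) (P *ᵥ z) ((hconj y z).2 hz)
      exact ⟨c, hinj (by rw [hc, mulVec_smul])⟩
    have hbe : ∀ i, Conjugate w (Pi.single i 1) (Pi.single i 1) := fun i =>
      (hconj _ _).1 (by rw [← he]; exact hself _)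
    have hbw : ∀ m, Conjugate w (w m) (w m) := fun m =>
      (hconj _ _).1 (by rw [← hvw]; exact hself _)
    obtain ⟨q, hq0, hq, hqe, hqw, hall⟩ := hw.exists_eighth_point
      (fun i => htriv _ (by simp) (hbe i))
      (fun m => htriv _ (fun h => hw.ne_zero m 0 (congrFun h 0)) (hbw m))
    refine ⟨Fin.cons (mk K (P *ᵥ q) (hP0 hq0)) s, Fin.cons_injective_iff.2 ⟨?_, hs⟩, ?_⟩
    · rintro ⟨i, hi⟩
      obtain ⟨a, ha⟩ := (mk_eq_mk_iff' K _ _ (hP0 hq0) (hv0 i)).1 hi.symm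
      induction i using Fin.addCases (m := 4) (n := 3) with
      | left i => exact hqe i a (hinj (by rw [hsingle, ← ha]))
      | right m => exact hqw m a (hinj (by rw [mulVec_smul, ← hvw, ← ha]))
    · rw [Fin.range_cons]
      ext x
      simp only [Set.mem_insert_iff, Set.mem_range]
      constructor
      · intro hx
        have hx' : NetConjugate v x.rep x.rep := hx
        obtain ⟨y, hy⟩ := hsurj x.rep
        have hx0 := x.rep_nonzero
        rw [hy, hconj] at hx'
        rw [← x.mk_rep]
        rcases hall y hx' with ⟨i, c, rfl⟩ | ⟨m, c, rfl⟩ | ⟨c, rfl⟩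
        · right
          refine ⟨Fin.castAdd 3 i, Eq.symm ((mk_eq_mk_iff' K _ _ hx0 (hv0 _)).2 ⟨c, ?_⟩)⟩
          rw [hy, hsingle]
        · right
          refine ⟨Fin.natAdd 4 m, Eq.symm ((mk_eq_mk_iff' K _ _ hx0 (hv0 _)).2 ⟨c, ?_⟩)⟩
          rw [hy, mulVec_smul, hvw]
        · left
          refine (mk_eq_mk_iff' K _ _ hx0 _).2 ⟨c, ?_⟩
          rw [hy, mulVec_smul]
      · rintro (rfl | ⟨i, rfl⟩)
        · exact (netConjugate_rep_mk _).2 ((hconj q q).2 hq)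
        · exact (netConjugate_rep_mk _).2 (hself i)
  · rintro ⟨p, hp, hbase⟩
    have hmem : ∀ {u} (hu : u ≠ 0), NetConjugate v u u → mk K u hu ∈ Set.range p :=
      fun hu h => hbase ▸ (netConjugate_rep_mk hu).2 h
    obtain ⟨k, hk⟩ : ∃ k, p k ∉ Set.range s := by
      by_contra! h
      choose g hg using h
      have : Function.Injective g := fun a b hab => hp (by rw [← hg a, ← hg b, hab])
      simpa using Fintype.card_le_of_injective g this
    obtain ⟨q, hq⟩ := hsurj (p k).rep
    have hpk : NetConjugate v (p k).rep (p k).rep := by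
      have : p k ∈ {x : Projectivization K (Fin 4 → K) | NetConjugate v x.rep x.rep} :=
        hbase ▸ Set.mem_range_self k
      exact this
    have hknot : ∀ i (c : K), (p k).rep ≠ c • v i := by
      intro i c h
      refine hk ⟨i, ?_⟩
      rw [← (p k).mk_rep]
      exact Eq.symm ((mk_eq_mk_iff' K _ _ (p k).rep_nonzero (hv0 i)).2 ⟨c, h.symm⟩)
    have hD : conicCross w ≠ 0 := by
      intro hD
      obtain ⟨S, f, hS, hf, hfS⟩ := hw.exists_infinite_of_conicCross_eq_zero hD
      have := hS.to_subtype
      let F : S → Projectivization K (Fin 4 → K) := fun τ => mk K _ (hP0 (hf τ τ.2).1)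
      have hF : Function.Injective F := by
        intro a b hab
        obtain ⟨c, hc⟩ := (mk_eq_mk_iff' K _ _ (hP0 (hf b b.2).1) (hP0 (hf a a.2).1)).1 hab.symm
        exact Subtype.ext (hfS a a.2 b b.2 c (hinj (by rw [mulVec_smul]; exact hc.symm)))
      refine (Set.infinite_range_of_injective hF) ((Set.finite_range p).subset ?_)
      rintro _ ⟨τ, rfl⟩
      exact hmem _ ((hconj _ _).2 (hf τ τ.2).2)
    intro u hu huu z hz
    obtain ⟨y, rfl⟩ := hsurj u
    obtain ⟨x, rfl⟩ := hsurj z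
    have hy0 : y ≠ 0 := by
      rintro rfl
      exact hu (mulVec_zero P)
    rw [hq, hconj] at hpk
    obtain ⟨c, rfl⟩ := hw.conjugateTrivial_of_eighth_point hD hpk
      (fun i c h => hknot _ c (by rw [hq, h, hsingle]))
      (fun m c h => hknot _ c (by rw [hq, h, mulVec_smul, hvw])) hy0 ((hconj _ _).1 huu) x
      ((hconj _ _).1 hz)
    exact ⟨c, mulVec_smul _ _ _⟩

theorem forall_mem_span_dotProduct_iff {A : Fin 3 → Matrix (Fin 4) (Fin 4) K} {u z : Fin 4 → K} :
    (∀ B ∈ Submodule.span K (Set.range A), u ⬝ᵥ B *ᵥ z = 0) ↔ ∀ k, u ⬝ᵥ A k *ᵥ z = 0 := by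
  refine ⟨fun h k => h _ (Submodule.subset_span ⟨k, rfl⟩), fun h B hB => ?_⟩
  obtain ⟨c, rfl⟩ := (Submodule.mem_span_range_iff_exists_fun K).1 hB
  simp [sum_mulVec, dotProduct_sum, smul_mulVec, h]

theorem forall_mem_span_rank_iff {A : Fin 3 → Matrix (Fin 4) (Fin 4) K}
    (hA : LinearIndependent K A) :
    (∀ B ∈ Submodule.span K (Set.range A), B ≠ 0 → 3 ≤ B.rank) ↔
      ∀ p ≠ 0, 3 ≤ (netMember A p).rank := by
  refine ⟨fun h p hp => h _ (netMember_mem_span p) (netMember_ne_zero hA hp), fun h B hB hB0 => ?_⟩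
  obtain ⟨p, rfl⟩ := (Submodule.mem_span_range_iff_exists_fun K).1 hB
  refine h p ?_
  rintro rfl
  simp at hB0

end Heptad

/-- Seven distinct points of `ℙ³` whose net of quadrics `L` (spanned by the quadratic forms of
the symmetric matrices `A 0, A 1, A 2`) is three-dimensional form an Aronhold heptad (every
quadric of the net is irreducible, i.e. of rank `≥ 3`, and the base locus of the net consists of
exactly eight distinct points) if and only if the Hessian quartic
`det (x·A₀ + y·A₁ + z·A₂)` is a smooth plane quartic. -/
theorem stmt_5 (v : Fin 7 → (Fin 4 → ℂ))
    (hv0 : ∀ i, v i ≠ 0)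
    (hvp : ∀ i j : Fin 7, i ≠ j → ∀ c : ℂ, v j ≠ c • v i)
    (A : Fin 3 → Matrix (Fin 4) (Fin 4) ℂ)
    (hAsymm : ∀ k, (A k).IsSymm)
    (hAli : LinearIndependent ℂ A)
    (hspan : ∀ B : Matrix (Fin 4) (Fin 4) ℂ,
      (B.IsSymm ∧ ∀ i, v i ⬝ᵥ B *ᵥ v i = 0) ↔ B ∈ Submodule.span ℂ (Set.range A))
    (Hq : MvPolynomial (Fin 3) ℂ)
    (hHq : Hq = Matrix.det (Matrix.of fun i j : Fin 4 =>
      X 0 * C (A 0 i j) + X 1 * C (A 1 i j) + X 2 * C (A 2 i j))) :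
    ((∀ B ∈ Submodule.span ℂ (Set.range A), B ≠ 0 → 3 ≤ B.rank) ∧
      ∃ p : Fin 8 → Projectivization ℂ (Fin 4 → ℂ), Function.Injective p ∧
        {x : Projectivization ℂ (Fin 4 → ℂ) |
          ∀ B ∈ Submodule.span ℂ (Set.range A), x.rep ⬝ᵥ B *ᵥ x.rep = 0} = Set.range p)
    ↔ ¬ ∃ p : Fin 3 → ℂ, p ≠ 0 ∧ eval p Hq = 0 ∧
        ∀ k : Fin 3, eval p (pderiv k Hq) = 0 := by
  have hnet : ∀ y z, NetConjugate v y z ↔ ∀ k, y ⬝ᵥ A k *ᵥ z = 0 := by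
    intro y z
    rw [← forall_mem_span_dotProduct_iff]
    simp only [NetConjugate, ← hspan, and_imp]
  subst hHq
  simp only [eval_hessian, eval_pderiv_hessian]
  rw [hessian_smooth_iff hAsymm, forall_mem_span_rank_iff hAli]
  refine and_congr_right fun hr => ?_
  have hirr : QuadricsIrreducible v := fun B hB hBv =>
    (forall_mem_span_rank_iff hAli).2 hr B ((hspan B).1 ⟨hB, hBv⟩)
  simpa only [IsTransversal, hnet, forall_mem_span_dotProduct_iff] using
    (hirr.transversal_iff hv0 hvp).symm
end
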